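/- arXiv:2402.10467 — 3 statements merged into one kernel-verified Lean document; each statement's English description precedes it below -/
import Mathlib

section
/- Let q ≥ 8 be a power of a prime with q = 2^(2m+1) for some positive integer m, and let G = PSL₂(q). Then for every non-trivial irreducible complex character χ of G and every irreducible complex character ψ of G, the inner product ⟨χ⁴, ψ⟩ is nonzero; that is, c(χ⁴) = Irr(G). -/
open scoped BigOperators

/-- The standard inner product of complex-valued class functions on a finite group:
`⟨α, β⟩ = |G|⁻¹ ∑ g, α g * conj (β g)`. -/
noncomputable def charInner {G : Type} [Group G] [Finite G] (α β : G → ℂ) : ℂ :=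
  letI : Fintype G := Fintype.ofFinite G
  (Fintype.card G : ℂ)⁻¹ * ∑ g : G, α g * (starRingEnd ℂ) (β g)

/-- `χ : G → ℂ` is an irreducible character if it is the character of some
irreducible (simple) finite-dimensional complex representation of `G`. -/
def IsIrreducibleCharacter (G : Type) [Group G] (χ : G → ℂ) : Prop :=
  ∃ V : FDRep ℂ G, CategoryTheory.Simple V ∧ χ = V.character

open CategoryTheory Module

open scoped ComplexOrder in
/-- A character of a finite group takes complex conjugate values at inverse elements. -/
lemma FDRep.character_inv_eq_conj {G : Type} [Group G] [Finite G] (V : FDRep ℂ G) (g : G) :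
    V.character g⁻¹ = starRingEnd ℂ (V.character g) := by
  classical
  have := Fintype.ofFinite G
  let b := finBasis ℂ V
  let A : G → Matrix (Fin (finrank ℂ V)) (Fin (finrank ℂ V)) ℂ :=
    fun h => LinearMap.toMatrix b b (V.ρ h)
  have hA1 : A 1 = 1 := by simp [A]
  have hAm (x y : G) : A (x * y) = A x * A y := by simp [A, LinearMap.toMatrix_mul]
  have htr (x : G) : V.character x = (A x).trace := by
    simp [A, FDRep.character, LinearMap.trace_eq_matrix_trace ℂ b]
  let H := ∑ h, (A h).conjTranspose * A h
  have hH : H.PosDef := by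
    have : H = 1 + ∑ h ∈ Finset.univ.erase (1 : G), (A h).conjTranspose * A h := by
      simp only [H]
      rw [← Finset.add_sum_erase _ _ (Finset.mem_univ (1 : G))]
      simp [hA1]
    rw [this]
    exact Matrix.PosDef.one.add_posSemidef
      (Matrix.posSemidef_sum _ fun h _ => Matrix.posSemidef_conjTranspose_mul_self _)
  have hinv : (A g).conjTranspose * H * A g = H := by
    simp only [H, Finset.mul_sum, Finset.sum_mul]
    rw [← Equiv.sum_comp (Equiv.mulRight g) (fun h => (A h).conjTranspose * A h)]
    refine Finset.sum_congr rfl fun h _ => ?_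
    simp [hAm, Matrix.conjTranspose_mul, mul_assoc]
  have hdet : IsUnit H.det := (Matrix.isUnit_iff_isUnit_det _).1 hH.isUnit
  have hg : A g * A g⁻¹ = 1 := by rw [← hAm, mul_inv_cancel, hA1]
  have h2 : (A g).conjTranspose * H = H * A g⁻¹ := by
    rw [← hinv, mul_assoc _ (A g), hg, mul_one, hinv]
  have h3 : A g⁻¹ = H⁻¹ * ((A g).conjTranspose * H) := by
    rw [h2, ← mul_assoc, Matrix.nonsing_inv_mul _ hdet, one_mul]
  rw [htr, htr, h3, Matrix.trace_mul_comm, mul_assoc, Matrix.mul_nonsing_inv _ hdet, mul_one,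
    Matrix.trace_conjTranspose]
  rfl

/-- The values of an irreducible character have square norms summing to the group order. -/
lemma FDRep.sum_norm_sq_character {G : Type} [Group G] [Fintype G] (V : FDRep ℂ G) [Simple V] :
    ∑ g, ‖V.character g‖ ^ 2 = Nat.card G := by
  have hc : (Nat.card G : ℂ) ≠ 0 := by exact_mod_cast Nat.card_pos.ne'
  let := invertibleOfNonzero hc
  have h := FDRep.char_orthonormal V V
  rw [if_pos ⟨Iso.refl V⟩, inv_mul_eq_iff_eq_mul₀ hc, mul_one] at h
  rw [← Complex.ofReal_inj]
  push_cast
  rw [← h]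
  refine Finset.sum_congr rfl fun g _ => ?_
  rw [FDRep.character_inv_eq_conj, Complex.mul_conj, Complex.normSq_eq_norm_sq]
  push_cast
  rfl

/-- The square norm of an irreducible character value is at most the centralizer order. -/
lemma FDRep.norm_sq_character_le_card_centralizer {G : Type} [Group G] [Finite G] (V : FDRep ℂ G)
    [Simple V] (g : G) :
    ‖V.character g‖ ^ 2 ≤ Nat.card (Subgroup.centralizer {g}) := by
  classical
  have := Fintype.ofFinite G
  have hfib (h : G) : (Finset.univ.filter fun x => x * g * x⁻¹ = h).card ≤
      Nat.card (Subgroup.centralizer {g}) := by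
    rcases Finset.eq_empty_or_nonempty (Finset.univ.filter fun x => x * g * x⁻¹ = h)
      with h0 | ⟨y, hy⟩
    · simp [h0]
    · rw [← SetLike.coe_sort_coe, Nat.card_eq_card_toFinset]
      refine Finset.card_le_card_of_injOn (fun x => y⁻¹ * x) ?_ (by simp)
      intro x hx
      simp only [Finset.coe_filter, Finset.mem_univ, true_and, Set.mem_ofPred_eq,
        Finset.mem_filter] at hx hy
      have := hx.trans hy.symm
      simp only [Set.coe_toFinset, SetLike.mem_coe, Subgroup.mem_centralizer_singleton_iff]
      have h1 : x * g = y * g * y⁻¹ * x := by rw [← this]; group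
      rw [mul_assoc, h1]; group
  have h1 : (Nat.card G : ℝ) * ‖V.character g‖ ^ 2 = ∑ x : G, ‖V.character (x * g * x⁻¹)‖ ^ 2 := by
    simp
  have h2 : ∑ x : G, ‖V.character (x * g * x⁻¹)‖ ^ 2 ≤
      ∑ h : G, Nat.card (Subgroup.centralizer {g}) * ‖V.character h‖ ^ 2 := by
    rw [← Finset.sum_fiberwise Finset.univ (fun x => x * g * x⁻¹)]
    refine Finset.sum_le_sum fun h _ => ?_
    rw [Finset.sum_congr rfl (g := fun _ => ‖V.character h‖ ^ 2)
      (fun x hx => by rw [(Finset.mem_filter.1 hx).2]), Finset.sum_const, nsmul_eq_mul]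
    gcongr
    exact hfib h
  rw [← Finset.mul_sum, FDRep.sum_norm_sq_character, ← h1, mul_comm] at h2
  exact le_of_mul_le_mul_right h2 (by exact_mod_cast Nat.card_pos)

/-- If all elements of `U` square to the identity, a representation of `U` whose character is
constant on nonidentity elements is trivial or has degree at least `|U| - 1`. -/
lemma Representation.trivial_or_card_sub_one_le_finrank {U V : Type*} [Group U] [Finite U]
    [AddCommGroup V] [Module ℂ V] [FiniteDimensional ℂ V] (ρ : Representation ℂ U V)
    (hsq : ∀ x : U, x * x = 1)
    (hconst : ∀ x y : U, x ≠ 1 → y ≠ 1 → ρ.character x = ρ.character y) :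
    (∀ x, ρ x = 1) ∨ Nat.card U - 1 ≤ finrank ℂ V := by
  classical
  have := Fintype.ofFinite U
  rcases subsingleton_or_nontrivial U with hU | hU
  · exact Or.inl fun x => by rw [Subsingleton.elim x 1, map_one]
  obtain ⟨x, hx⟩ := exists_ne (1 : U)
  have hc : (Nat.card U : ℂ) ≠ 0 := by exact_mod_cast Nat.card_pos.ne'
  let := invertibleOfNonzero hc
  have hn := ρ.card_inv_mul_sum_char_eq_finrank
  rw [inv_mul_eq_iff_eq_mul₀ hc, ← Finset.add_sum_erase _ _ (Finset.mem_univ (1 : U)),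
    Finset.sum_congr rfl (g := fun _ => ρ.character x)
      (fun y hy => hconst y x (Finset.ne_of_mem_erase hy) hx), Finset.sum_const,
    Finset.card_erase_of_mem (Finset.mem_univ _), Finset.card_univ, nsmul_eq_mul,
    Representation.char_one, ← Nat.card_eq_fintype_card, Nat.cast_sub Nat.card_pos] at hn
  have hidem : IsIdempotentElem ((2⁻¹ : ℂ) • (1 - ρ x)) := by
    have h2 : ρ x * ρ x = 1 := by rw [← map_mul, hsq, map_one]
    have h3 : (1 - ρ x) * (1 - ρ x) = (2 : ℂ) • (1 - ρ x) := by
      rw [mul_sub, sub_mul, sub_mul, h2, two_smul]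
      simp only [mul_one, one_mul]
      abel
    rw [IsIdempotentElem, smul_mul_smul_comm, h3, smul_smul]
    norm_num
  have hk := (LinearMap.IsIdempotentElem.isProj_range _ hidem).trace
  set k := finrank ℂ (LinearMap.range ((2⁻¹ : ℂ) • (1 - ρ x)))
  set n := finrank ℂ ρ.invariants with hnd
  have hnle : n ≤ finrank ℂ V := Submodule.finrank_le _
  have hχ : ρ.character x = finrank ℂ V - 2 * k := by
    rw [map_smul, map_sub, LinearMap.trace_one, smul_eq_mul] at hk
    rw [← hk, Representation.character]
    ring
  rw [hχ] at hn
  have hmain : Nat.card U * (finrank ℂ V - n) = 2 * k * (Nat.card U - 1) := by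
    have : 1 ≤ Nat.card U := Nat.card_pos
    have : ((Nat.card U * (finrank ℂ V - n) : ℕ) : ℂ) = (2 * k * (Nat.card U - 1) : ℕ) := by
      push_cast [Nat.cast_sub hnle, Nat.cast_sub this]
      linear_combination hn
    exact_mod_cast this
  have hdvd : Nat.card U - 1 ∣ finrank ℂ V - n := by
    refine Nat.Coprime.dvd_of_dvd_mul_left ?_ (Dvd.intro_left _ hmain.symm)
    have h1 : 1 ≤ Nat.card U := Nat.card_pos
    have := Nat.coprime_self_add_right (m := Nat.card U - 1) (n := 1)
    rw [Nat.sub_add_cancel h1] at this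
    exact this.2 (Nat.coprime_one_right _)
  rcases Nat.eq_zero_or_pos (finrank ℂ V - n) with h0 | hpos
  · left
    have htop : ρ.invariants = ⊤ := Submodule.eq_top_of_finrank_eq (by omega)
    intro y
    ext v
    have : v ∈ ρ.invariants := htop ▸ Submodule.mem_top
    simpa using this y
  · right
    exact (Nat.le_of_dvd hpos hdvd).trans (Nat.sub_le _ _)

/-- A nontrivial irreducible character of a simple group containing
an elementary abelian `2`-group `U` whose involutions are conjugate has degree at least
`|U| - 1`. -/
lemma FDRep.card_sub_one_le_finrank {G U : Type} [Group G] [Finite G] [IsSimpleGroup G] [Group U]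
    [Finite U] [Nontrivial U] (φ : U →* G) (hφ : Function.Injective φ)
    (hsq : ∀ x : U, x * x = 1) (hconj : ∀ x y : U, x ≠ 1 → y ≠ 1 → IsConj (φ x) (φ y))
    (V : FDRep ℂ G) [Simple V] (hV : V.character ≠ fun _ => 1) :
    Nat.card U - 1 ≤ finrank ℂ V := by
  have := Fintype.ofFinite G
  let σ : Representation ℂ U V := V.ρ.comp φ
  have hσ (x : U) : σ.character x = V.character (φ x) := rfl
  refine (σ.trivial_or_card_sub_one_le_finrank hsq fun x y hx hy => ?_).resolve_left fun h => hV ?_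
  · obtain ⟨c, hc⟩ := isConj_iff.1 (hconj x y hx hy)
    rw [hσ, hσ, ← hc, FDRep.char_conj]
  obtain ⟨x, hx⟩ := exists_ne (1 : U)
  have hker : V.ρ.ker = ⊤ := by
    refine ((inferInstance : V.ρ.ker.Normal).eq_bot_or_eq_top).resolve_left fun hbot => hx ?_
    have : φ x ∈ V.ρ.ker := h x
    rw [hbot, Subgroup.mem_bot] at this
    exact hφ (this.trans (map_one φ).symm)
  have hchar (g : G) : V.character g = finrank ℂ V := by
    have : V.ρ g = 1 := by
      have : g ∈ V.ρ.ker := hker ▸ Subgroup.mem_top g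
      exact this
    rw [FDRep.character, this, LinearMap.trace_one]
  have hs := FDRep.sum_norm_sq_character V
  simp only [hchar, Complex.norm_natCast, Finset.sum_const, Finset.card_univ, nsmul_eq_mul,
    ← Nat.card_eq_fintype_card] at hs
  have h1 : (finrank ℂ V) ^ 2 = 1 := by
    have : Nat.card G * (finrank ℂ V) ^ 2 = Nat.card G * 1 := by rw [mul_one]; exact_mod_cast hs
    exact Nat.eq_of_mul_eq_mul_left Nat.card_pos this
  funext g
  have h2 : finrank ℂ V = 1 := by simpa using h1
  rw [hchar, h2, Nat.cast_one]

/-- Real numerical inequality used to compare the identity term with the remaining ones. -/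
lemma add_one_mul_sqrt_mul_lt {q : ℝ} (hq : 8 ≤ q) :
    (q + 1) * √(q + 1) * (q ^ 2 + 1) < (q - 1) ^ 4 := by
  have hs : √(q + 1) ≤ (q + 10) / 6 := by
    refine Real.sqrt_le_iff.2 ⟨by linarith, ?_⟩
    nlinarith [sq_nonneg (q - 8)]
  calc (q + 1) * √(q + 1) * (q ^ 2 + 1) ≤ (q + 1) * ((q + 10) / 6) * (q ^ 2 + 1) := by gcongr
    _ < (q - 1) ^ 4 := by
      obtain ⟨t, rfl⟩ : ∃ t, q = 8 + t := ⟨q - 8, by ring⟩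
      have ht : 0 ≤ t := by linarith
      have : 0 < (8 + t - 1) ^ 4 - (8 + t + 1) * ((8 + t + 10) / 6) * ((8 + t) ^ 2 + 1) := by
        ring_nf
        positivity
      linarith

/-- Fourth powers of nontrivial irreducible characters contain every irreducible character in a
finite group in which all elements are real, with suitable bounds on the group order, the
centralizer orders and the degrees. -/
lemma charInner_pow_four_ne_zero {G : Type} [Group G] [Finite G] (q : ℕ) (hq : 8 ≤ q)
    (hcard : Nat.card G ≤ q * (q ^ 2 - 1)) (hreal : ∀ g : G, IsConj g g⁻¹)
    (hcent : ∀ g : G, g ≠ 1 → Nat.card (Subgroup.centralizer {g}) ≤ q + 1)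
    (hdeg : ∀ V : FDRep ℂ G, Simple V → V.character ≠ (fun _ => 1) → q - 1 ≤ finrank ℂ V)
    (V W : FDRep ℂ G) [Simple V] [Simple W] (hV : V.character ≠ fun _ => 1) :
    charInner (fun g => V.character g ^ 4) W.character ≠ 0 := by
  classical
  unfold charInner
  let : Fintype G := Fintype.ofFinite G
  refine mul_ne_zero (inv_ne_zero (by exact_mod_cast Fintype.card_ne_zero)) ?_
  have hq' : (8 : ℝ) ≤ q := by exact_mod_cast hq
  have hd : (q : ℝ) - 1 ≤ finrank ℂ V := by
    have := hdeg V inferInstance hV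
    rw [sub_le_iff_le_add]
    exact_mod_cast Nat.sub_le_iff_le_add.1 this
  by_cases hW : W.character = fun _ => 1
  · have hrl (g : G) : ((V.character g).re : ℂ) = V.character g := by
      obtain ⟨c, hc⟩ := isConj_iff.1 (hreal g)
      rw [← Complex.conj_eq_iff_re, ← FDRep.character_inv_eq_conj, ← hc, FDRep.char_conj]
    have : ∑ g : G, V.character g ^ 4 * (starRingEnd ℂ) (W.character g) =
        ((∑ g : G, (V.character g).re ^ 4 : ℝ) : ℂ) := by
      push_cast
      simp [hW, hrl]
    rw [this, Complex.ofReal_ne_zero]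
    refine (Finset.sum_pos' (fun g _ => by positivity) ⟨1, Finset.mem_univ _, ?_⟩).ne'
    rw [FDRep.char_one, Complex.natCast_re]
    exact pow_pos (by linarith) 4
  · have hd' : (q : ℝ) - 1 ≤ finrank ℂ W := by
      have := hdeg W inferInstance hW
      rw [sub_le_iff_le_add]
      exact_mod_cast Nat.sub_le_iff_le_add.1 this
    rw [← Finset.add_sum_erase _ _ (Finset.mem_univ (1 : G)), FDRep.char_one]
    intro h0
    simp only [FDRep.char_one] at h0
    set d : ℝ := (finrank ℂ V : ℝ)
    set e : ℝ := (finrank ℂ W : ℝ)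
    have hnorm : d ^ 4 * e = ‖∑ g ∈ Finset.univ.erase (1 : G),
        V.character g ^ 4 * (starRingEnd ℂ) (W.character g)‖ := by
      rw [← norm_neg, ← eq_neg_of_add_eq_zero_left h0]
      simp [d, e]
    have hbound : ‖∑ g ∈ Finset.univ.erase (1 : G),
        V.character g ^ 4 * (starRingEnd ℂ) (W.character g)‖ ≤
        ∑ g ∈ Finset.univ.erase (1 : G), (q + 1) * √(q + 1) * ‖V.character g‖ ^ 2 := by
      refine norm_sum_le_of_le _ fun g hg => ?_
      have hc : (Nat.card (Subgroup.centralizer {g}) : ℝ) ≤ q + 1 := by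
        exact_mod_cast hcent g (Finset.ne_of_mem_erase hg)
      have h1 := (V.norm_sq_character_le_card_centralizer g).trans hc
      have h2 : ‖W.character g‖ ≤ √(q + 1) :=
        Real.le_sqrt_of_sq_le ((W.norm_sq_character_le_card_centralizer g).trans hc)
      rw [norm_mul, norm_pow, RCLike.norm_conj]
      calc ‖V.character g‖ ^ 4 * ‖W.character g‖
          = ‖V.character g‖ ^ 2 * ‖W.character g‖ * ‖V.character g‖ ^ 2 := by ring
        _ ≤ _ := by gcongr
    have hsum : d ^ 2 + ∑ g ∈ Finset.univ.erase (1 : G), ‖V.character g‖ ^ 2 = Nat.card G := by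
      rw [← V.sum_norm_sq_character, ← Finset.add_sum_erase _ _ (Finset.mem_univ (1 : G))]
      simp [d]
    have hcard' : (Nat.card G : ℝ) ≤ q * (q ^ 2 - 1) := by
      have h1 : 1 ≤ q ^ 2 := Nat.one_le_pow _ _ (by omega)
      have : (Nat.card G : ℝ) ≤ (q * (q ^ 2 - 1) : ℕ) := by exact_mod_cast hcard
      rwa [Nat.cast_mul, Nat.cast_sub h1, Nat.cast_pow, Nat.cast_one] at this
    rw [← Finset.mul_sum, ← hnorm] at hbound
    have hrest : ∑ g ∈ Finset.univ.erase (1 : G), ‖V.character g‖ ^ 2 ≤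
        ((q : ℝ) - 1) * (q ^ 2 + 1) := by
      have : ((q : ℝ) - 1) ^ 2 ≤ d ^ 2 := pow_le_pow_left₀ (by linarith) hd 2
      nlinarith
    have hlow : ((q : ℝ) - 1) ^ 4 * (q - 1) ≤ d ^ 4 * e := by
      have : (0 : ℝ) ≤ q - 1 := by linarith
      gcongr
    have hup : (q + 1) * √(q + 1) * ∑ g ∈ Finset.univ.erase (1 : G), ‖V.character g‖ ^ 2 ≤
        (q + 1) * √(q + 1) * (((q : ℝ) - 1) * (q ^ 2 + 1)) := by gcongr
    have hlt := mul_lt_mul_of_pos_right (add_one_mul_sqrt_mul_lt hq')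
      (by linarith : (0 : ℝ) < q - 1)
    nlinarith

open Matrix in
/-- The special linear group of degree two over a finite field with `q` elements has at most
`q (q² - 1)` elements. -/
lemma card_specialLinearGroup_fin_two_le {F : Type*} [Field F] [Finite F] :
    Nat.card (SpecialLinearGroup (Fin 2) F) ≤ Nat.card F * (Nat.card F ^ 2 - 1) := by
  classical
  have := Fintype.ofFinite F
  have hne : Nat.card {v : F × F // v ≠ 0} = Nat.card F ^ 2 - 1 := by
    rw [Nat.card_eq_fintype_card, Fintype.card_subtype_compl, Fintype.card_subtype_eq,
      Fintype.card_prod, Nat.card_eq_fintype_card, sq]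
  have hdet (g : SpecialLinearGroup (Fin 2) F) : g 0 0 * g 1 1 - g 0 1 * g 1 0 = 1 := by
    rw [← det_fin_two]
    exact g.det_coe
  have hrow (g : SpecialLinearGroup (Fin 2) F) : (g 1 0, g 1 1) ≠ 0 := fun h => by
    have h1 := congrArg Prod.fst h
    have h2 := congrArg Prod.snd h
    simpa [show g 1 0 = 0 from h1, show g 1 1 = 0 from h2] using hdet g
  rw [← hne, ← Nat.card_prod]
  refine Nat.card_le_card_of_injective
    (fun g => (if g 1 0 = 0 then g 0 1 else g 0 0, ⟨(g 1 0, g 1 1), hrow g⟩)) fun g h hgh => ?_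
  simp only [Prod.mk.injEq, Subtype.mk.injEq] at hgh
  obtain ⟨h1, h2, h3⟩ := hgh
  have hg := hdet g
  have hh := hdet h
  rw [h2, h3] at hg
  rw [h2] at h1
  have key : g 0 0 = h 0 0 ∧ g 0 1 = h 0 1 := by
    split_ifs at h1 with hc
    · rw [hc] at hg hh
      have hd : h 1 1 ≠ 0 := fun h0 => by simp [h0] at hh
      exact ⟨mul_right_cancel₀ hd (by linear_combination hg - hh), h1⟩
    · exact ⟨h1, mul_right_cancel₀ hc (by linear_combination hh - hg + h 1 1 * h1)⟩
  ext i j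
  fin_cases i <;> fin_cases j
  exacts [key.1, key.2, h2, h3]

/-- The conic `x² + t x y + y² = 1` over a finite field of characteristic two with `q` elements has
at most `q + 1` points. -/
lemma card_conic_le {F : Type*} [Field F] [CharP F 2] [Finite F] (t : F) :
    Nat.card {p : F × F // p.1 ^ 2 + t * p.1 * p.2 + p.2 ^ 2 = 1} ≤ Nat.card F + 1 := by
  classical
  have h2 : (2 : F) = 0 := CharTwo.two_eq_zero
  rw [← Finite.card_option]
  by_cases ht : t = 0
  · refine Nat.card_le_card_of_injective (fun p => some p.1.2) ?_
    rintro ⟨⟨x, y⟩, hp⟩ ⟨⟨x', y'⟩, hp'⟩ h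
    simp only [Option.some.injEq, ht] at h hp hp'
    subst h
    have : (x - x') ^ 2 = 0 := by linear_combination hp - hp' + (x' ^ 2 - x * x') * h2
    rw [Subtype.mk.injEq, sub_eq_zero.1 (pow_eq_zero_iff two_ne_zero |>.1 this)]
  · refine Nat.card_le_card_of_injective
      (fun p => if p.1.2 = 0 then none else some ((p.1.1 + 1) / p.1.2)) ?_
    rintro ⟨⟨x, y⟩, hp⟩ ⟨⟨x', y'⟩, hp'⟩ h
    simp only at h hp hp'
    rw [Subtype.mk.injEq, Prod.mk.injEq]
    split_ifs at h with hy hy' hy'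
    · subst hy hy'
      have : (x - x') ^ 2 = 0 := by linear_combination hp - hp' + (x' ^ 2 - x * x') * h2
      exact ⟨sub_eq_zero.1 (pow_eq_zero_iff two_ne_zero |>.1 this), rfl⟩
    · rw [Option.some.injEq] at h
      obtain ⟨m, hm⟩ : ∃ m, (x + 1) / y = m := ⟨_, rfl⟩
      rw [hm] at h
      rw [div_eq_iff hy] at hm
      rw [eq_div_iff hy'] at h
      have e1 : y * (m ^ 2 + t * m + 1) = t := mul_right_cancel₀ hy (by
        obtain rfl : x = m * y - 1 := by linear_combination hm
        linear_combination hp + m * y * h2)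
      have e2 : y' * (m ^ 2 + t * m + 1) = t := mul_right_cancel₀ hy' (by
        obtain rfl : x' = m * y' - 1 := by linear_combination -h
        linear_combination hp' + m * y' * h2)
      have hyy : y = y' :=
        mul_right_cancel₀ (right_ne_zero_of_mul (e1.trans_ne ht)) (e1.trans e2.symm)
      subst hyy
      exact ⟨by linear_combination hm + h, rfl⟩

namespace Matrix.SpecialLinearGroup

variable {F : Type*} [Field F] [CharP F 2]

/-- In characteristic two every element of `SL₂` is conjugate to its inverse. -/
lemma isConj_inv_of_charTwo (g : SpecialLinearGroup (Fin 2) F) : IsConj g g⁻¹ := by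
  have h2 : (2 : F) = 0 := CharTwo.two_eq_zero
  suffices ∃ s : SpecialLinearGroup (Fin 2) F,
      s 0 0 = s 1 1 ∧ s 0 0 * (g 0 0 + g 1 1) + s 0 1 * g 1 0 + s 1 0 * g 0 1 = 0 by
    obtain ⟨s, h1, h3⟩ := this
    rw [isConj_iff]
    refine ⟨s, ?_⟩
    rw [mul_inv_eq_iff_eq_mul]
    ext i j
    fin_cases i <;> fin_cases j <;>
      simp only [coe_mul, coe_inv, adjugate_fin_two, mul_apply, Fin.sum_univ_two, Fin.zero_eta,
        Fin.mk_one, of_apply, cons_val', cons_val_zero, cons_val_one, cons_val_fin_one]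
    · linear_combination h3 - s 0 0 * g 1 1 * h2
    · linear_combination s 0 0 * g 0 1 * h2 - g 0 1 * h1
    · linear_combination s 0 0 * g 1 0 * h2 - g 1 0 * h1
    · linear_combination h3 - s 1 1 * g 0 0 * h2 - (g 0 0 + g 1 1) * h1
  by_cases hc : g 1 0 = 0
  · by_cases hb : g 0 1 = 0
    · exact ⟨⟨!![0, 1; 1, 0], by rw [det_fin_two_of]; linear_combination -h2⟩, rfl,
        by simp [hb, hc]⟩
    · refine ⟨⟨!![1, 0; -(g 0 0 + g 1 1) / g 0 1, 1], by simp [det_fin_two_of]⟩, rfl, ?_⟩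
      simp [hc, hb]
  · refine ⟨⟨!![1, -(g 0 0 + g 1 1) / g 1 0; 0, 1], by simp [det_fin_two_of]⟩, rfl, ?_⟩
    simp [hc]

/-- In characteristic two, an element commuting with a nonidentity `g ∈ SL₂` is a linear
combination of the identity and `g`. -/
lemma exists_eq_smul_one_add_smul_of_commute {g h : SpecialLinearGroup (Fin 2) F} (hg : g ≠ 1)
    (hgh : h * g = g * h) :
    ∃ p : F × F,
      (h : Matrix (Fin 2) (Fin 2) F) = p.1 • 1 + p.2 • (g : Matrix (Fin 2) (Fin 2) F) := by
  have hdet : g 0 0 * g 1 1 - g 0 1 * g 1 0 = 1 := by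
    rw [← det_fin_two]
    exact g.det_coe
  have h2 : (2 : F) = 0 := CharTwo.two_eq_zero
  have e (i j : Fin 2) := congrArg (fun s : SpecialLinearGroup (Fin 2) F => s i j) hgh
  simp only [coe_mul, mul_apply, Fin.sum_univ_two] at e
  have e00 := e 0 0
  have e01 := e 0 1
  have e10 := e 1 0
  suffices ∃ x y : F, h 0 0 = x + y * g 0 0 ∧ h 0 1 = y * g 0 1 ∧ h 1 0 = y * g 1 0 ∧
      h 1 1 = x + y * g 1 1 by
    obtain ⟨x, y, h00, h01, h10, h11⟩ := this
    refine ⟨(x, y), ?_⟩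
    ext i j
    fin_cases i <;> fin_cases j <;> simp [h00, h01, h10, h11]
  by_cases hc : g 1 0 = 0
  · by_cases hb : g 0 1 = 0
    · have had : g 0 0 - g 1 1 ≠ 0 := fun h0 => hg <| by
        rw [hb] at hdet
        have : (g 0 0 - 1) ^ 2 = 0 := by linear_combination hdet + g 0 0 * h0 + (1 - g 0 0) * h2
        have ha : g 0 0 = 1 := sub_eq_zero.1 (pow_eq_zero_iff two_ne_zero |>.1 this)
        have hd : g 1 1 = 1 := by linear_combination ha - h0
        ext i j
        fin_cases i <;> fin_cases j <;> simp [ha, hb, hc, hd]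
      have hb' : h 0 1 = 0 :=
        mul_right_cancel₀ had (by linear_combination -e01 + (h 0 0 - h 1 1) * hb)
      have hc' : h 1 0 = 0 :=
        mul_right_cancel₀ had (by linear_combination e10 + (h 0 0 - h 1 1) * hc)
      refine ⟨h 1 1 - (h 0 0 - h 1 1) / (g 0 0 - g 1 1) * g 1 1,
        (h 0 0 - h 1 1) / (g 0 0 - g 1 1), ?_, by rw [hb, hb', mul_zero], by rw [hc, hc', mul_zero],
        by ring⟩
      field_simp
      ring
    · refine ⟨h 1 1 - h 0 1 / g 0 1 * g 1 1, h 0 1 / g 0 1, ?_, by field_simp, ?_, by ring⟩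
      · field_simp
        linear_combination e01
      · field_simp
        linear_combination -e00
  · refine ⟨h 1 1 - h 1 0 / g 1 0 * g 1 1, h 1 0 / g 1 0, ?_, ?_, by field_simp, by ring⟩
    · field_simp
      linear_combination -e10
    · field_simp
      linear_combination e00

/-- Over a field of characteristic two with `q` elements, centralizers of nonidentity elements of
`SL₂` have at most `q + 1` elements. -/
lemma card_centralizer_le [Finite F] {g : SpecialLinearGroup (Fin 2) F} (hg : g ≠ 1) :
    Nat.card (Subgroup.centralizer {g}) ≤ Nat.card F + 1 := by
  have hdet : g 0 0 * g 1 1 - g 0 1 * g 1 0 = 1 := by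
    rw [← det_fin_two]
    exact g.det_coe
  choose p hp using fun h : Subgroup.centralizer {g} =>
    exists_eq_smul_one_add_smul_of_commute hg (Subgroup.mem_centralizer_singleton_iff.1 h.2)
  have hconic (h : Subgroup.centralizer {g}) :
      (p h).1 ^ 2 + (g 0 0 + g 1 1) * (p h).1 * (p h).2 + (p h).2 ^ 2 = 1 := by
    have := (h : SpecialLinearGroup (Fin 2) F).det_coe
    rw [hp, det_fin_two] at this
    simp only [add_apply, smul_apply, smul_eq_mul, one_apply_eq, mul_one,
      one_apply_ne zero_ne_one, one_apply_ne one_ne_zero, mul_zero, zero_add] at this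
    linear_combination this - (p h).2 ^ 2 * hdet
  refine le_trans (Nat.card_le_card_of_injective (fun h => ⟨p h, hconic h⟩) fun h k hhk => ?_)
    (card_conic_le (g 0 0 + g 1 1))
  refine Subtype.ext (Subtype.ext ?_)
  rw [hp, hp, Subtype.mk.inj hhk]

/-- Upper unitriangular matrices, as a homomorphism from the additive group of the field. -/
def upperTransvectionHom (F : Type*) [Field F] :
    Multiplicative F →* SpecialLinearGroup (Fin 2) F where
  toFun b := transvection zero_ne_one b.toAdd
  map_one' := transvection_coeff_zero _
  map_mul' _ _ := transvection_add _ _ _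

lemma upperTransvectionHom_injective {F : Type*} [Field F] :
    Function.Injective (upperTransvectionHom F) := by
  intro b c h
  have := congrArg (fun s : SpecialLinearGroup (Fin 2) F => s 0 1) h
  simpa [upperTransvectionHom, transvection_coe] using this

/-- Over a finite field of characteristic two, all nonidentity upper unitriangular matrices in
`SL₂` are conjugate. -/
lemma isConj_upperTransvectionHom [Finite F] {b c : Multiplicative F} (hb : b ≠ 1) (hc : c ≠ 1) :
    IsConj (upperTransvectionHom F b) (upperTransvectionHom F c) := by
  have hb' : b.toAdd ≠ 0 := hb
  have hc' : c.toAdd ≠ 0 := hc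
  obtain ⟨t, ht⟩ := FiniteField.isSquare_of_char_two (ringChar.eq F 2) (c.toAdd / b.toAdd)
  have ht0 : t ≠ 0 := by
    rintro rfl
    simp [hb', hc'] at ht
  rw [div_eq_iff hb'] at ht
  let D : SpecialLinearGroup (Fin 2) F := ⟨!![t, 0; 0, t⁻¹], by simp [det_fin_two_of, ht0]⟩
  refine isConj_iff.2 ⟨D, ?_⟩
  have hD : (D : Matrix (Fin 2) (Fin 2) F) = !![t, 0; 0, t⁻¹] := rfl
  have hu (b : Multiplicative F) :
      (upperTransvectionHom F b : Matrix (Fin 2) (Fin 2) F) = !![1, b.toAdd; 0, 1] := by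
    ext i j
    fin_cases i <;> fin_cases j <;> simp [upperTransvectionHom, transvection_coe]
  rw [mul_inv_eq_iff_eq_mul]
  refine Subtype.ext ?_
  rw [coe_mul, coe_mul, hu, hu, hD, ht]
  ext i j
  fin_cases i <;> fin_cases j <;> simp [mul_apply, Fin.sum_univ_two]
  field_simp

end Matrix.SpecialLinearGroup

/-- For `q = 2^(2m+1) ≥ 8`, every non-trivial irreducible character `χ` of `PSL₂(q)`
satisfies `c(χ⁴) = Irr(PSL₂(q))`: the fourth power of `χ` contains every irreducible
character of `PSL₂(q)`. -/
theorem psl2_char_covering_fourth_power_even_case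
    (q : ℕ) (hq8 : 8 ≤ q) (hq : ∃ m : ℕ, 1 ≤ m ∧ q = 2 ^ (2 * m + 1))
    (F : Type) [Field F] [Fintype F] (hF : Fintype.card F = q)
    (χ ψ : Matrix.ProjectiveSpecialLinearGroup (Fin 2) F → ℂ)
    (hχ : IsIrreducibleCharacter _ χ) (hχ_nontriv : χ ≠ fun _ => 1)
    (hψ : IsIrreducibleCharacter _ ψ) :
    charInner (fun g => χ g ^ 4) ψ ≠ 0 := by
  obtain ⟨V, hV, rfl⟩ := hχ
  obtain ⟨W, hW, rfl⟩ := hψ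
  obtain ⟨m, -, hm⟩ := hq
  have h2 : (2 : F) = 0 := by
    have := Nat.cast_card_eq_zero F
    rw [hF, hm, Nat.cast_pow] at this
    exact (pow_eq_zero_iff (by omega)).1 this
  have : CharP F 2 := CharTwo.of_one_ne_zero_of_two_eq_zero one_ne_zero h2
  have hF' : Nat.card F = q := by rw [Nat.card_eq_fintype_card, hF]
  have := Matrix.ProjectiveSpecialLinearGroup.rank_two_simple (F := F) (by omega)
  let π := QuotientGroup.mk' (Subgroup.center (Matrix.SpecialLinearGroup (Fin 2) F))
  have hinj : Function.Injective π := by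
    rw [← MonoidHom.ker_eq_bot_iff, QuotientGroup.ker_mk', eq_bot_iff]
    intro g hg
    obtain ⟨r, hr, hrg⟩ := Matrix.SpecialLinearGroup.mem_center_iff.1 hg
    rw [Fintype.card_fin] at hr
    have hr0 : (r - 1) ^ 2 = 0 := by linear_combination hr + (1 - r) * h2
    rw [sub_eq_zero.1 (pow_eq_zero_iff two_ne_zero |>.1 hr0), map_one] at hrg
    exact Subtype.ext hrg.symm
  let e := MulEquiv.ofBijective π ⟨hinj, QuotientGroup.mk'_surjective _⟩
  refine charInner_pow_four_ne_zero q hq8 ?_ (fun g => ?_) (fun g hg => ?_) (fun V _ hV => ?_)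
    V W hχ_nontriv
  · rw [← hF', ← Nat.card_congr e.toEquiv]
    exact card_specialLinearGroup_fin_two_le
  · obtain ⟨g, rfl⟩ := e.surjective g
    rw [← map_inv]
    exact e.toMonoidHom.map_isConj (Matrix.SpecialLinearGroup.isConj_inv_of_charTwo g)
  · obtain ⟨g, rfl⟩ := e.surjective g
    have hg1 : g ≠ 1 := fun h => hg (by rw [h, map_one])
    have hmem (h : Subgroup.centralizer {e g}) : e.symm h ∈ Subgroup.centralizer {g} := by
      have := Subgroup.mem_centralizer_singleton_iff.1 h.2
      rw [Subgroup.mem_centralizer_singleton_iff, ← e.injective.eq_iff]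
      simpa using this
    exact (Nat.card_le_card_of_injective (fun h => ⟨e.symm h, hmem h⟩) fun h k hhk =>
      Subtype.ext (e.symm.injective (Subtype.mk.inj hhk))).trans
      ((Matrix.SpecialLinearGroup.card_centralizer_le hg1).trans_eq (by rw [hF']))
  · have := FDRep.card_sub_one_le_finrank
      (π.comp (Matrix.SpecialLinearGroup.upperTransvectionHom F))
      (hinj.comp Matrix.SpecialLinearGroup.upperTransvectionHom_injective)
      (fun x => CharTwo.add_self_eq_zero x.toAdd)
      (fun x y hx hy => π.map_isConj
        (Matrix.SpecialLinearGroup.isConj_upperTransvectionHom hx hy)) V hV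
    rwa [← hF']
end

section
/- Let q = 2^(2m+1) ≥ 8 for some positive integer m, and let G = PSL₂(q) = SL₂(F_q). Then there exists a non-trivial irreducible complex character χ of G of degree q − 1 such that ⟨χ³, 1⟩ = 0, where 1 is the trivial character; in particular c(χ³) ≠ Irr(G), so the character covering number of G is not 3. -/
open scoped BigOperators

namespace LinearMap

variable {k V W : Type*} [Field k] [AddCommGroup V] [Module k V] [FiniteDimensional k V]
  [AddCommGroup W] [Module k W] [FiniteDimensional k W]

/-- If a surjection `p` intertwines `b` and `c`, the trace of `b` is the sum of the traces of its
restriction to the kernel of `p` and of `c`. -/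
theorem trace_restrict_ker_add_trace (p : V →ₗ[k] W) (hp : Function.Surjective p)
    (b : V →ₗ[k] V) (c : W →ₗ[k] W) (hbc : p ∘ₗ b = c ∘ₗ p)
    (hb : ∀ x ∈ ker p, b x ∈ ker p) :
    trace k (ker p) (b.restrict hb) + trace k W c = trace k V b := by
  obtain ⟨s, hs⟩ := p.exists_rightInverse_of_surjective (range_eq_top.2 hp)
  let r : V →ₗ[k] ker p := (LinearMap.id - s ∘ₗ p).codRestrict (ker p) fun x ↦ by
    have h : p (s (p x)) = p x := LinearMap.congr_fun hs (p x)
    simp [h]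
  have h1 : b.restrict hb = r ∘ₗ (b ∘ₗ (ker p).subtype) := by
    ext x
    have : p (b x) = 0 := hb x x.2
    simp [r, this]
  have h2 : c = p ∘ₗ (b ∘ₗ s) := by
    rw [← comp_assoc, hbc, comp_assoc, hs, comp_id]
  have h3 : (ker p).subtype ∘ₗ r = LinearMap.id - s ∘ₗ p := rfl
  rw [h1, trace_comp_comm', h2, trace_comp_comm' (b ∘ₗ s) p, ← map_add, comp_assoc, comp_assoc,
    ← comp_add, h3, sub_add_cancel, comp_id]

end LinearMap

namespace Representation

variable {k G V W : Type*} [Field k] [Group G] [AddCommGroup V] [Module k V]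
  [FiniteDimensional k V] [AddCommGroup W] [Module k W] [FiniteDimensional k W]
  {ρ : Representation k G V} {σ : Representation k G W}

theorem character_ker_add_character (f : IntertwiningMap ρ σ) (hf : Function.Surjective f) (g : G) :
    f.ker.toRepresentation.character g + σ.character g = ρ.character g :=
  LinearMap.trace_restrict_ker_add_trace f.toLinearMap hf (ρ g) (σ g)
    (LinearMap.ext fun v ↦ IntertwiningMap.isIntertwining _ _ f g v) (f.ker.apply_mem_toSubmodule g)

theorem character_toRepresentation_of_isProj (N : Subrepresentation ρ) {P : V →ₗ[k] V}
    (hP : LinearMap.IsProj N.toSubmodule P) (g : G) :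
    N.toRepresentation.character g = LinearMap.trace k V (ρ g ∘ₗ P) := by
  have h : N.toRepresentation g = hP.codRestrict ∘ₗ (ρ g ∘ₗ N.toSubmodule.subtype) := by
    ext x
    exact (hP.map_id _ (N.apply_mem_toSubmodule g x.2)).symm
  rw [character, h, LinearMap.trace_comp_comm', LinearMap.comp_assoc,
    hP.subtype_comp_codRestrict]

/-- The intertwining map onto the range. -/
def IntertwiningMap.rangeRestrict (f : IntertwiningMap ρ σ) :
    IntertwiningMap ρ f.range.toRepresentation where
  toLinearMap := f.toLinearMap.rangeRestrict
  isIntertwining' g := by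
    ext v
    exact IntertwiningMap.isIntertwining _ _ f g v

/-- The intertwining map onto a quotient representation. -/
def IntertwiningMap.quotientMk (N : Subrepresentation σ) :
    IntertwiningMap σ (σ.quotient N.toSubmodule fun g ↦ N.apply_mem_toSubmodule g) where
  toLinearMap := N.toSubmodule.mkQ
  isIntertwining' _ := rfl

/-- Removing a common constituent, the image of an intertwining map, does not change the
difference of two characters. -/
theorem character_sub_character_eq (f : IntertwiningMap ρ σ) (g : G) :
    f.ker.toRepresentation.character g -
      (σ.quotient f.range.toSubmodule fun g ↦ f.range.apply_mem_toSubmodule g).character g =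
    ρ.character g - σ.character g := by
  have h1 := character_ker_add_character f.rangeRestrict f.toLinearMap.surjective_rangeRestrict g
  have h2 := character_ker_add_character (IntertwiningMap.quotientMk f.range)
    (Submodule.mkQ_surjective _) g
  have h3 : f.rangeRestrict.ker = f.ker :=
    Subrepresentation.toSubmodule_injective f.toLinearMap.ker_rangeRestrict
  have h4 : (IntertwiningMap.quotientMk f.range).ker = f.range :=
    Subrepresentation.toSubmodule_injective (Submodule.ker_mkQ _)
  rw [h3] at h1
  rw [h4] at h2
  linear_combination h1 - h2

end Representation

/-- A difference of two characters which has norm one and positive degree is an irreducible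
character. -/
theorem isIrreducibleCharacter_sub {G : Type} [Group G] [Fintype G] {V W : Type}
    [AddCommGroup V] [Module ℂ V] [FiniteDimensional ℂ V]
    [AddCommGroup W] [Module ℂ W] [FiniteDimensional ℂ W]
    (ρ : Representation ℂ G V) (σ : Representation ℂ G W)
    (hdim : Module.finrank ℂ W < Module.finrank ℂ V)
    (hnorm : ∑ g : G, (ρ.character g - σ.character g) * (ρ.character g⁻¹ - σ.character g⁻¹) =
      Nat.card G) :
    ∃ S : FDRep ℂ G, CategoryTheory.Simple S ∧
      (fun g ↦ ρ.character g - σ.character g) = S.character := by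
  induction hn : Module.finrank ℂ W using Nat.strong_induction_on generalizing V W with
  | _ n ih =>
  subst hn
  by_cases hf : ∃ f : Representation.IntertwiningMap ρ σ, f ≠ 0
  · obtain ⟨f, hf⟩ := hf
    have hdim1 := f.toLinearMap.finrank_range_add_finrank_ker
    have hdim2 := f.range.toSubmodule.finrank_quotient_add_finrank
    have hpos : 0 < Module.finrank ℂ f.range.toSubmodule := by
      rw [Module.finrank_pos_iff, Submodule.nontrivial_iff_ne_bot]
      intro h
      exact hf (Representation.IntertwiningMap.ext (LinearMap.range_eq_bot.1 h))
    change _ + Module.finrank ℂ f.ker.toSubmodule = _ at hdim1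
    change Module.finrank ℂ f.range.toSubmodule + _ = _ at hdim1
    simp_rw [← Representation.character_sub_character_eq f] at hnorm ⊢
    exact ih _ (by omega) _ _ (by omega) hnorm rfl
  · push Not at hf
    have hsub : Subsingleton (Representation.IntertwiningMap ρ σ) :=
      ⟨fun a b ↦ (hf a).trans (hf b).symm⟩
    have hG : (Nat.card G : ℂ) ≠ 0 := NeZero.ne _
    let _ := invertibleOfNonzero hG
    have h12 := Representation.card_inv_mul_sum_char_mul_char_eq_finrank ρ σ
    have h11 := Representation.card_inv_mul_sum_char_mul_char_eq_finrank ρ ρ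
    have h22 := Representation.card_inv_mul_sum_char_mul_char_eq_finrank σ σ
    rw [Module.finrank_zero_of_subsingleton] at h12
    have h21 : ∑ g : G, ρ.character g * σ.character g⁻¹ =
        ∑ g : G, σ.character g * ρ.character g⁻¹ := by
      rw [← Equiv.sum_comp (Equiv.inv G)]
      simp [mul_comm]
    have hV : 0 < Module.finrank ℂ (Representation.IntertwiningMap ρ ρ) := by
      have : Nontrivial V := (Module.finrank_pos_iff (R := ℂ)).1 (by omega)
      rw [Module.finrank_pos_iff_exists_ne_zero]
      refine ⟨.id ρ, fun h ↦ ?_⟩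
      obtain ⟨v, hv⟩ := exists_ne (0 : V)
      exact hv (DFunLike.congr_fun h v)
    have hsum : ((Module.finrank ℂ (Representation.IntertwiningMap ρ ρ) +
        Module.finrank ℂ (Representation.IntertwiningMap σ σ) : ℕ) : ℂ) = (1 : ℕ) := by
      push_cast
      rw [← h11, ← h22]
      simp only [mul_sub, sub_mul, Finset.sum_sub_distrib] at hnorm
      field_simp at h12 ⊢
      simp only [Nat.cast_zero, mul_zero] at h12
      linear_combination hnorm + h21 + 2 * h12
    rw [Nat.cast_inj] at hsum
    have hW0 : Module.finrank ℂ (Representation.IntertwiningMap σ σ) = 0 := by omega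
    have hW : Subsingleton W := by
      rw [Module.finrank_zero_iff] at hW0
      exact ⟨fun a b ↦ DFunLike.congr_fun (Subsingleton.elim
        (Representation.IntertwiningMap.id σ) 0) a |>.trans (DFunLike.congr_fun (Subsingleton.elim
        (Representation.IntertwiningMap.id σ) 0) b).symm⟩
    have hσ (g : G) : σ.character g = 0 := by
      rw [Representation.character, Subsingleton.elim (σ g) 0, map_zero]
    simp only [hσ, sub_zero] at hnorm ⊢
    exact ⟨FDRep.of ρ, (FDRep.simple_iff_char_is_norm_one _).2 hnorm, rfl⟩

section Induced

variable {G H : Type} [Group G] [Fintype G] [Group H] [Fintype H]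

open scoped Classical in
/-- The character of `G` induced from a linear character `θ` of `H` along a homomorphism
`φ : H →* G`. -/
noncomputable def inducedCharacter (φ : H →* G) (θ : H →* ℂˣ) (g : G) : ℂ :=
  (Fintype.card H : ℂ)⁻¹ * ∑ x : G, ∑ h : H, if x * g * x⁻¹ = φ h then (θ h : ℂ) else 0

/-- Right translation on functions on `G`. -/
def rightTranslation (G : Type) [Group G] : Representation ℂ G (G → ℂ) where
  toFun g := LinearMap.funLeft ℂ ℂ (· * g)
  map_one' := by ext; simp [LinearMap.funLeft]
  map_mul' _ _ := by ext; simp [LinearMap.funLeft, mul_assoc]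

omit [Fintype G] [Fintype H] in
@[simp]
theorem rightTranslation_apply (g x : G) (f : G → ℂ) : rightTranslation G g f x = f (x * g) := rfl

/-- The functions on `G` which transform under left translation by `H` according to `θ`. -/
def inducedSubrepresentation (φ : H →* G) (θ : H →* ℂˣ) :
    Subrepresentation (rightTranslation G) where
  toSubmodule :=
    { carrier := {f | ∀ h x, f (φ h * x) = θ h * f x}
      add_mem' := fun ha hb h x ↦ by simp [ha h x, hb h x, mul_add]
      zero_mem' := by simp
      smul_mem' := fun c f hf h x ↦ by simp [hf h x, mul_left_comm] }
  apply_mem_toSubmodule g f hf h x := by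
    simpa [mul_assoc] using hf h (x * g)

/-- Averaging over `H` projects onto the induced representation. -/
noncomputable def inducedProjection (φ : H →* G) (θ : H →* ℂˣ) : (G → ℂ) →ₗ[ℂ] (G → ℂ) where
  toFun f x := (Fintype.card H : ℂ)⁻¹ * ∑ h : H, θ h * f (φ h⁻¹ * x)
  map_add' f f' := by ext; simp [mul_add, Finset.sum_add_distrib]
  map_smul' c f := by ext; simp [mul_left_comm, Finset.mul_sum]

omit [Fintype G] in
theorem inducedProjection_apply (φ : H →* G) (θ : H →* ℂˣ) (f : G → ℂ) (x : G) :
    inducedProjection φ θ f x = (Fintype.card H : ℂ)⁻¹ * ∑ h : H, θ h * f (φ h⁻¹ * x) := rfl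

omit [Fintype G] in
theorem isProj_inducedProjection (φ : H →* G) (θ : H →* ℂˣ) :
    LinearMap.IsProj (inducedSubrepresentation φ θ).toSubmodule (inducedProjection φ θ) where
  map_mem f h x := by
    rw [inducedProjection_apply, inducedProjection_apply, mul_left_comm]
    congr 1
    rw [Finset.mul_sum, ← Equiv.sum_comp (Equiv.mulLeft h)]
    simp [mul_assoc]
  map_id f hf := by
    ext x
    have hf' : ∀ h x, f (φ h * x) = θ h * f x := hf
    simp_rw [inducedProjection_apply, hf', ← mul_assoc, ← Units.val_mul, ← map_mul]
    simp

/-- The trace formula for the induced representation. -/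
theorem character_inducedSubrepresentation (φ : H →* G) (θ : H →* ℂˣ) (g : G) :
    (inducedSubrepresentation φ θ).toRepresentation.character g = inducedCharacter φ θ g := by
  classical
  rw [Representation.character_toRepresentation_of_isProj _ (isProj_inducedProjection φ θ),
    LinearMap.trace_eq_matrix_trace ℂ (Pi.basisFun ℂ G), Matrix.trace, inducedCharacter,
    Finset.mul_sum]
  refine Finset.sum_congr rfl fun x _ ↦ ?_
  simp only [Matrix.diag_apply, LinearMap.toMatrix_apply, Pi.basisFun_repr, Pi.basisFun_apply]
  rw [LinearMap.comp_apply, rightTranslation_apply, inducedProjection_apply]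
  congr 1
  refine Finset.sum_congr rfl fun h _ ↦ ?_
  have : (φ h)⁻¹ * (x * g) = x ↔ x * g * x⁻¹ = φ h := by
    rw [inv_mul_eq_iff_eq_mul, mul_inv_eq_iff_eq_mul]
  simp [Pi.single_apply, this]

/-- Frobenius reciprocity. -/
theorem sum_inducedCharacter_mul (φ : H →* G) (θ : H →* ℂˣ) (f : G → ℂ)
    (hf : ∀ x g, f (x * g * x⁻¹) = f g) :
    ∑ g, inducedCharacter φ θ g * f g =
      Fintype.card G * ((Fintype.card H : ℂ)⁻¹ * ∑ h, θ h * f (φ h)) := by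
  classical
  have key (x : G) (h : H) :
      ∑ g, (if x * g * x⁻¹ = φ h then (θ h : ℂ) else 0) * f g = θ h * f (φ h) := by
    rw [Finset.sum_eq_single (x⁻¹ * φ h * x)]
    · rw [← hf x (x⁻¹ * φ h * x)]
      simp [mul_assoc]
    · intro g _ hg
      rw [if_neg, zero_mul]
      rintro h'
      exact hg (by rw [← h']; group)
    · simp
  calc ∑ g, inducedCharacter φ θ g * f g
      = (Fintype.card H : ℂ)⁻¹ * ∑ x : G, ∑ h, ∑ g,
          (if x * g * x⁻¹ = φ h then (θ h : ℂ) else 0) * f g := by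
        simp_rw [inducedCharacter, mul_assoc, ← Finset.mul_sum, Finset.sum_mul]
        rw [Finset.sum_comm]
        congr 2; ext x
        rw [Finset.sum_comm]
    _ = _ := by
        simp_rw [key]
        simp
        ring

theorem inducedCharacter_conj (φ : H →* G) (θ : H →* ℂˣ) (x g : G) :
    inducedCharacter φ θ (x * g * x⁻¹) = inducedCharacter φ θ g := by
  simp_rw [← character_inducedSubrepresentation, Representation.char_conj]

/-- If no conjugate of `g` lies in the image of `φ`, the induced character vanishes at `g`. -/
theorem inducedCharacter_eq_zero (φ : H →* G) (θ : H →* ℂˣ) (g : G)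
    (hg : ∀ x h, x * g * x⁻¹ ≠ φ h) : inducedCharacter φ θ g = 0 := by
  simp [inducedCharacter, hg]

omit [Fintype G] in
open scoped Classical in
theorem sum_ite_conj_eq {φ : H →* G} (hφ : Function.Injective φ) (θ : H →* ℂˣ) {x g : G} {h₀ : H}
    (h : x * g * x⁻¹ = φ h₀) :
    (∑ h : H, if x * g * x⁻¹ = φ h then (θ h : ℂ) else 0) = θ h₀ := by
  simp [h, hφ.eq_iff]

theorem inducedCharacter_one (φ : H →* G) (hφ : Function.Injective φ) (θ : H →* ℂˣ) :
    inducedCharacter φ θ 1 = (Fintype.card H : ℂ)⁻¹ * Fintype.card G := by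
  classical
  have (h : H) : 1 = φ h ↔ h = 1 := by rw [eq_comm, map_eq_one_iff φ hφ]
  simp [inducedCharacter, this]

end Induced

theorem exists_orderOf_eq_of_dvd_card {H : Type} [CommGroup H] [Finite H] (p : ℕ) [Fact p.Prime]
    (h : p ∣ Nat.card H) : ∃ θ : H →* ℂˣ, orderOf θ = p := by
  obtain ⟨e⟩ := CommGroup.monoidHom_mulEquiv_of_hasEnoughRootsOfUnity H ℂ
  obtain ⟨x, hx⟩ := exists_prime_orderOf_dvd_card' p h
  exact ⟨e.symm x, by rw [MulEquiv.orderOf_eq, hx]⟩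

namespace Matrix.SpecialLinearGroup

theorem card_fin_two (F : Type*) [Field F] [Fintype F] :
    (Nat.card (SpecialLinearGroup (Fin 2) F) : ℂ) =
      Fintype.card F * (Fintype.card F - 1) * (Fintype.card F + 1) := by
  classical
  have hGL := Matrix.card_GL_field (𝔽 := F) 2
  have hq : 1 < Fintype.card F := Fintype.one_lt_card
  have hdet : Function.Surjective (GeneralLinearGroup.det : GL (Fin 2) F →* Fˣ) := by
    intro u
    exact ⟨GeneralLinearGroup.mk' !![(u : F), 0; 0, 1]
      (by simpa using invertibleOfNonzero u.ne_zero),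
      Units.ext (by simp)⟩
  have hker : (toGL : SpecialLinearGroup (Fin 2) F →* GL (Fin 2) F).range =
      GeneralLinearGroup.det.ker := by
    ext g
    refine ⟨?_, fun hg ↦ ⟨⟨g.1, by simpa using congrArg Units.val (MonoidHom.mem_ker.1 hg)⟩,
      Units.ext rfl⟩⟩
    rintro ⟨x, rfl⟩
    exact MonoidHom.mem_ker.2 (Units.ext (by simp))
  have hcard := (GeneralLinearGroup.det : GL (Fin 2) F →* Fˣ).ker.card_mul_index
  rw [Subgroup.index_ker, MonoidHom.range_eq_top.2 hdet, ← hker, hGL, Subgroup.card_top,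
    Nat.card_units, Nat.card_eq_fintype_card (α := F), Fin.prod_univ_two,
    ← Nat.card_congr (MonoidHom.ofInjective toGL_injective).toEquiv] at hcard
  have hcard' := congrArg (Nat.cast : ℕ → ℂ) hcard
  have hsq : Fintype.card F ≤ Fintype.card F ^ 2 := Nat.le_self_pow two_ne_zero _
  have hsq' : 1 ≤ Fintype.card F ^ 2 := Nat.one_le_pow _ _ (by lia)
  simp only [Fin.val_zero, Fin.val_one, pow_zero, pow_one] at hcard'
  push_cast [Nat.cast_sub hsq, Nat.cast_sub hsq', Nat.cast_sub hq.le] at hcard'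
  have hne : (Fintype.card F : ℂ) - 1 ≠ 0 := by
    rw [sub_ne_zero]
    exact_mod_cast hq.ne'
  apply mul_right_cancel₀ hne
  rw [hcard']
  ring

variable {F : Type} [Field F]

/-- The upper unitriangular matrices. -/
def unipotent (F : Type) [Field F] : Multiplicative F →* SpecialLinearGroup (Fin 2) F where
  toFun b := ⟨!![1, b.toAdd; 0, 1], by simp⟩
  map_one' := Subtype.ext (by change !![1, 0; 0, 1] = 1; simp [one_fin_two])
  map_mul' a b := Subtype.ext (by
    change _ = !![1, a.toAdd; 0, 1] * !![1, b.toAdd; 0, 1]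
    simp [add_comm])

theorem unipotent_apply (b : Multiplicative F) :
    (unipotent F b : Matrix (Fin 2) (Fin 2) F) = !![1, b.toAdd; 0, 1] := rfl

theorem unipotent_injective : Function.Injective (unipotent F) := fun _ _ h ↦
  congrArg (fun g : SpecialLinearGroup (Fin 2) F ↦ g.1 0 1) h

/-- In characteristic two, the norm-one elements of `F[X] / (X ^ 2 + X + 1)` acting on that
algebra. -/
def torus (F : Type) [Field F] [CharP F 2] : Subgroup (SpecialLinearGroup (Fin 2) F) where
  carrier := {g | g.1 1 0 = g.1 0 1 ∧ g.1 1 1 = g.1 0 0 + g.1 0 1}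
  mul_mem' {x y} hx hy := by
    simp only [Set.mem_ofPred_eq, coe_mul, mul_apply, Fin.sum_univ_two] at hx hy ⊢
    rw [hx.1, hx.2, hy.1, hy.2]
    constructor <;> ring
  one_mem' := by simp
  inv_mem' {x} hx := by
    simp only [Set.mem_ofPred_eq, coe_inv, adjugate_fin_two, cons_val', cons_val_zero, cons_val_one,
      cons_val_fin_one, of_apply, CharTwo.neg_eq] at hx ⊢
    refine ⟨hx.1, ?_⟩
    rw [hx.2, add_assoc, CharTwo.add_self_eq_zero, add_zero]

variable [CharP F 2]

theorem mem_torus {g : SpecialLinearGroup (Fin 2) F} :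
    g ∈ torus F ↔ g.1 1 0 = g.1 0 1 ∧ g.1 1 1 = g.1 0 0 + g.1 0 1 := Iff.rfl

theorem torus_ext {x y : SpecialLinearGroup (Fin 2) F} (hx : x ∈ torus F) (hy : y ∈ torus F)
    (h0 : x.1 0 0 = y.1 0 0) (h1 : x.1 0 1 = y.1 0 1) : x = y := by
  rw [mem_torus] at hx hy
  ext i j
  fin_cases i <;> fin_cases j <;> simp [hx.1, hx.2, hy.1, hy.2, h0, h1]

theorem torus_norm {x : SpecialLinearGroup (Fin 2) F} (hx : x ∈ torus F) :
    x.1 0 0 ^ 2 + x.1 0 0 * x.1 0 1 + x.1 0 1 ^ 2 = 1 := by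
  rw [mem_torus] at hx
  have h := x.det_coe
  rw [det_fin_two, hx.1, hx.2] at h
  have h2 : (2 : F) = 0 := CharTwo.two_eq_zero
  linear_combination h + x.1 0 1 ^ 2 * h2

instance : IsMulCommutative (torus F) :=
  ⟨⟨fun x y ↦ Subtype.ext <| by
    have hx := mem_torus.1 x.2
    have hy := mem_torus.1 y.2
    refine torus_ext (x * y).2 (y * x).2 ?_ ?_ <;>
      simp only [Subgroup.coe_mul, coe_mul, mul_apply, Fin.sum_univ_two, hx.1, hx.2, hy.1, hy.2] <;>
      ring⟩⟩

theorem eq_one_of_mem_torus_of_apply_zero_one {x : SpecialLinearGroup (Fin 2) F}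
    (hx : x ∈ torus F) (h : x.1 0 1 = 0) : x = 1 := by
  refine torus_ext hx (torus F).one_mem ?_ (by simp [h])
  have := torus_norm hx
  rw [h] at this
  have h2 : (2 : F) = 0 := CharTwo.two_eq_zero
  have : (x.1 0 0 - 1) ^ 2 = 0 := by linear_combination this - (x.1 0 0 - 1) * h2
  simpa [sub_eq_zero] using this

/-- The element inverting the torus. -/
def torusInverter (F : Type) [Field F] [CharP F 2] : SpecialLinearGroup (Fin 2) F :=
  ⟨!![0, 1; 1, 0], by simp [CharTwo.neg_eq]⟩

theorem coe_torusInverter :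
    (torusInverter F : Matrix (Fin 2) (Fin 2) F) = !![0, 1; 1, 0] := rfl

theorem torusInverter_notMem : torusInverter F ∉ torus F := by
  simp [mem_torus, coe_torusInverter]

theorem torusInverter_mul_self : torusInverter F * torusInverter F = 1 := by
  ext i j; fin_cases i <;> fin_cases j <;> simp [coe_torusInverter]

theorem torusInverter_conj {x : SpecialLinearGroup (Fin 2) F} (hx : x ∈ torus F) :
    torusInverter F * x * (torusInverter F)⁻¹ = x⁻¹ := by
  have hx' := mem_torus.1 hx
  rw [mul_inv_eq_iff_eq_mul]
  ext i j
  fin_cases i <;> fin_cases j <;>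
    simp [coe_torusInverter, coe_inv, adjugate_fin_two, mul_apply, Fin.sum_univ_two, hx'.1, hx'.2,
      CharTwo.neg_eq]

omit [CharP F 2] in
theorem trace_conj (x g : SpecialLinearGroup (Fin 2) F) :
    (x * g * x⁻¹).1.trace = g.1.trace := by
  rw [coe_mul, trace_mul_comm, ← coe_mul, inv_mul_cancel_left]

theorem trace_of_mem_torus {x : SpecialLinearGroup (Fin 2) F} (hx : x ∈ torus F) :
    x.1.trace = x.1 0 1 := by
  rw [trace_fin_two, (mem_torus.1 hx).2, ← add_assoc, CharTwo.add_self_eq_zero, zero_add]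

theorem trace_unipotent (b : Multiplicative F) : (unipotent F b).1.trace = 0 := by
  rw [trace_fin_two]
  exact CharTwo.add_self_eq_zero 1

/-- Elements conjugating a nontrivial element of the torus into the torus normalize it. -/
theorem mem_torus_or_of_conj_mem {t x : SpecialLinearGroup (Fin 2) F} (ht : t ∈ torus F)
    (ht1 : t ≠ 1) (hx : x * t * x⁻¹ ∈ torus F) : x ∈ torus F ∨ torusInverter F * x ∈ torus F := by
  have hb : t.1 0 1 ≠ 0 := fun h ↦ ht1 (eq_one_of_mem_torus_of_apply_zero_one ht h)
  have htr := trace_conj x t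
  rw [trace_of_mem_torus ht, trace_of_mem_torus hx] at htr
  have hxt : x * t * x⁻¹ * x = x * t := by group
  generalize x * t * x⁻¹ = s at *
  have h2 : (2 : F) = 0 := CharTwo.two_eq_zero
  have hn := (torus_norm hx).trans (torus_norm ht).symm
  rw [htr] at hn
  have ht' := mem_torus.1 ht
  have key (i j) : (s * x).1 i j = (x * t).1 i j := by rw [hxt]
  have k00 := key 0 0
  have k01 := key 0 1
  simp only [coe_mul, mul_apply, Fin.sum_univ_two, ht'.1, ht'.2, htr] at k00 k01
  have hcases : (s.1 0 0 - t.1 0 0) * (s.1 0 0 - (t.1 0 0 + t.1 0 1)) = 0 := by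
    linear_combination hn + (t.1 0 0 ^ 2 + t.1 0 0 * t.1 0 1 - s.1 0 0 * t.1 0 0
      - s.1 0 0 * t.1 0 1) * h2
  rcases mul_eq_zero.1 hcases with h | h <;> rw [sub_eq_zero] at h <;> rw [h] at k00 k01
  · left
    rw [mem_torus]
    constructor <;> apply mul_left_cancel₀ hb
    · linear_combination k00
    · linear_combination k01
  · right
    rw [mem_torus]
    simp only [coe_mul, coe_torusInverter, mul_apply, Fin.sum_univ_two, cons_val', cons_val_zero,
      cons_val_one, cons_val_fin_one, of_apply, zero_mul, one_mul, zero_add, add_zero]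
    constructor <;> apply mul_left_cancel₀ hb
    · linear_combination - k01
    · linear_combination - k00 - k01

end Matrix.SpecialLinearGroup
namespace Matrix.SpecialLinearGroup

variable {F : Type} [Field F] [CharP F 2]

theorem card_torus [Fintype F] (hirr : ∀ r : F, r ^ 2 + r + 1 ≠ 0) :
    Nat.card (torus F) = Fintype.card F + 1 := by
  classical
  have h2 : (2 : F) = 0 := CharTwo.two_eq_zero
  let f (x : torus F) : Option F := if x.1.1 0 1 = 0 then none else some (x.1.1 0 0 / x.1.1 0 1)
  have hf : Function.Bijective f := by
    constructor
    · intro x y h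
      by_cases hx : x.1.1 0 1 = 0 <;> by_cases hy : y.1.1 0 1 = 0 <;>
        simp only [f, hx, hy, if_true, if_false, reduceCtorEq, Option.some.injEq] at h
      · exact Subtype.ext ((eq_one_of_mem_torus_of_apply_zero_one x.2 hx).trans
          (eq_one_of_mem_torus_of_apply_zero_one y.2 hy).symm)
      · have hnx := torus_norm x.2
        have hny := torus_norm y.2
        rw [(div_eq_iff hx).1 h] at hnx
        generalize hr : y.1.1 0 0 / y.1.1 0 1 = r at *
        rw [div_eq_iff hy] at hr
        rw [hr] at hny
        have hsq : (x.1.1 0 1 - y.1.1 0 1) ^ 2 = 0 := by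
          apply (mul_eq_zero.1 _).resolve_left (hirr r)
          linear_combination hnx + hny +
            (1 - x.1.1 0 1 * y.1.1 0 1 * (r ^ 2 + r + 1)) * h2
        have h01 : x.1.1 0 1 = y.1.1 0 1 := sub_eq_zero.1 (pow_eq_zero_iff two_ne_zero |>.1 hsq)
        exact Subtype.ext (torus_ext x.2 y.2 (by rw [(div_eq_iff hx).1 h, hr, h01]) h01)
    · rintro (_ | r)
      · exact ⟨1, by simp [f]⟩
      · obtain ⟨s, hs⟩ := FiniteField.isSquare_of_char_two (ringChar.eq_iff.2 inferInstance)
          (r ^ 2 + r + 1)⁻¹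
        have hs' : s ^ 2 * (r ^ 2 + r + 1) = 1 := by
          rw [pow_two, ← hs, inv_mul_cancel₀ (hirr r)]
        have hs0 : s ≠ 0 := by
          rintro rfl
          simp at hs'
        refine ⟨⟨⟨!![r * s, s; s, r * s + s], ?_⟩, ?_⟩, ?_⟩
        · rw [det_fin_two_of]
          linear_combination hs' - s ^ 2 * h2
        · exact ⟨rfl, rfl⟩
        · simp [f, hs0]
  rw [Nat.card_congr (Equiv.ofBijective f hf), Nat.card_eq_fintype_card, Fintype.card_option]

section

variable [Fintype (SpecialLinearGroup (Fin 2) F)] [Fintype (torus F)]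

/-- The parametrization of the normalizer of the torus by two copies of the torus. -/
def torusNormalizerMap (F : Type) [Field F] [CharP F 2] :
    torus F ⊕ torus F → SpecialLinearGroup (Fin 2) F
  | .inl x => x
  | .inr x => torusInverter F * x

omit [Fintype (SpecialLinearGroup (Fin 2) F)] [Fintype (torus F)] in
theorem torusNormalizerMap_injective : Function.Injective (torusNormalizerMap F) := by
  have hne (x y : torus F) : (x : SpecialLinearGroup (Fin 2) F) ≠ torusInverter F * y := by
    intro h
    refine torusInverter_notMem (F := F) ?_
    rw [← mul_inv_eq_iff_eq_mul.2 h]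
    exact (torus F).mul_mem x.2 ((torus F).inv_mem y.2)
  rintro (x | x) (y | y) h
  · exact congrArg _ (Subtype.ext h)
  · exact (hne _ _ h).elim
  · exact (hne _ _ h.symm).elim
  · exact congrArg _ (Subtype.ext (mul_left_cancel h))

theorem inducedCharacter_torus (θ : torus F →* ℂˣ) {t : torus F} (ht : t ≠ 1) :
    inducedCharacter (torus F).subtype θ t = θ t + θ t⁻¹ := by
  have ht' : (t : SpecialLinearGroup (Fin 2) F) ≠ 1 := by simpa using ht
  have hcard : (Fintype.card (torus F) : ℂ) ≠ 0 := by simp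
  rw [inducedCharacter, inv_mul_eq_iff_eq_mul₀ hcard, mul_add]
  refine (Fintype.sum_of_injective _ torusNormalizerMap_injective
      (Sum.elim (fun _ ↦ (θ t : ℂ)) (fun _ ↦ (θ t⁻¹ : ℂ))) _ ?_ ?_).symm.trans
        (by simp [Fintype.sum_sum_type])
  · intro x hx
    refine Finset.sum_eq_zero fun h _ ↦ if_neg fun heq ↦ hx ?_
    have hmem : x * t * x⁻¹ ∈ torus F := by
      rw [heq]
      exact h.2
    rcases mem_torus_or_of_conj_mem t.2 ht' hmem with hx | hx
    · exact ⟨.inl ⟨x, hx⟩, rfl⟩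
    · exact ⟨.inr ⟨torusInverter F * x, hx⟩, by
        simp [torusNormalizerMap, ← mul_assoc, torusInverter_mul_self]⟩
  · have hcomm (x : torus F) :
        (x : SpecialLinearGroup (Fin 2) F) * t * (x : SpecialLinearGroup (Fin 2) F)⁻¹ = t := by
      rw [mul_inv_eq_iff_eq_mul]
      exact congrArg Subtype.val (Std.Commutative.comm (op := (· * · : torus F → _ → _)) x t)
    rintro (x | x)
    · exact (sum_ite_conj_eq (torus F).subtype_injective θ (hcomm x)).symm
    · refine (sum_ite_conj_eq (torus F).subtype_injective θ ?_).symm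
      rw [Subgroup.subtype_apply, Subgroup.coe_inv, ← torusInverter_conj t.2]
      nth_rw 2 [← hcomm x]
      simp only [torusNormalizerMap]
      group

variable [Fintype F]

omit [Fintype (torus F)] in
theorem inducedCharacter_unipotent_of_mem_torus (ψ : Multiplicative F →* ℂˣ)
    {t : SpecialLinearGroup (Fin 2) F} (ht : t ∈ torus F) (ht1 : t ≠ 1) :
    inducedCharacter (unipotent F) ψ t = 0 := by
  refine inducedCharacter_eq_zero _ _ _ fun x h heq ↦ ht1 ?_
  refine eq_one_of_mem_torus_of_apply_zero_one ht ?_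
  rw [← trace_of_mem_torus ht, ← trace_conj x, heq, trace_unipotent]

omit [Fintype F] in
theorem inducedCharacter_torus_of_unipotent (θ : torus F →* ℂˣ) {b : Multiplicative F}
    (hb : b ≠ 1) : inducedCharacter (torus F).subtype θ (unipotent F b) = 0 := by
  refine inducedCharacter_eq_zero _ _ _ fun x h heq ↦ hb ?_
  have h1 : (h : SpecialLinearGroup (Fin 2) F) = 1 := by
    refine eq_one_of_mem_torus_of_apply_zero_one h.2 ?_
    rw [← trace_of_mem_torus h.2, ← Subgroup.subtype_apply, ← heq, trace_conj, trace_unipotent]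
  rw [Subgroup.subtype_apply, h1, mul_inv_eq_one, mul_eq_left] at heq
  exact unipotent_injective (heq.trans (map_one _).symm)

end

end Matrix.SpecialLinearGroup
theorem sum_eq_zero_of_ne_one {H : Type} [Group H] [Fintype H] {θ : H →* ℂˣ} (hθ : θ ≠ 1) :
    ∑ h, (θ h : ℂ) = 0 := by
  refine sum_hom_units_eq_zero ((Units.coeHom ℂ).comp θ) fun h ↦ hθ ?_
  ext x
  exact DFunLike.congr_fun h x

namespace Matrix.SpecialLinearGroup

variable {F : Type} [Field F] [CharP F 2]

/-- The parametrization of the upper triangular matrices. -/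
def borelMap (F : Type) [Field F] (x : Fˣ × F) : SpecialLinearGroup (Fin 2) F :=
  ⟨!![(x.1 : F), x.2; 0, (x.1 : F)⁻¹], by simp⟩

omit [CharP F 2] in
theorem coe_borelMap (x : Fˣ × F) :
    (borelMap F x : Matrix (Fin 2) (Fin 2) F) = !![(x.1 : F), x.2; 0, (x.1 : F)⁻¹] := rfl

omit [CharP F 2] in
theorem borelMap_injective : Function.Injective (borelMap F) := fun _ _ h ↦
  Prod.ext (Units.ext (congrArg (fun g : SpecialLinearGroup (Fin 2) F ↦ g.1 0 0) h))
    (congrArg (fun g : SpecialLinearGroup (Fin 2) F ↦ g.1 0 1) h)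

omit [CharP F 2] in
theorem mem_range_borelMap {g : SpecialLinearGroup (Fin 2) F} (hg : g.1 1 0 = 0) :
    g ∈ Set.range (borelMap F) := by
  have hdet := g.det_coe
  rw [det_fin_two, hg, mul_zero, sub_zero] at hdet
  have h0 : g.1 0 0 ≠ 0 := left_ne_zero_of_mul_eq_one hdet
  refine ⟨(Units.mk0 _ h0, g.1 0 1), ?_⟩
  ext i j
  fin_cases i <;> fin_cases j <;> simp [coe_borelMap, hg, inv_eq_of_mul_eq_one_right hdet]

omit [CharP F 2] in
theorem borelMap_conj_unipotent (x : Fˣ × F) (b : F) :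
    borelMap F x * unipotent F (.ofAdd b) * (borelMap F x)⁻¹ =
      unipotent F (.ofAdd ((x.1 : F) ^ 2 * b)) := by
  rw [mul_inv_eq_iff_eq_mul]
  apply Subtype.ext
  simp only [coe_mul, coe_borelMap, unipotent_apply, toAdd_ofAdd]
  have := x.1.ne_zero
  ext i j
  fin_cases i <;> fin_cases j <;> simp
  field_simp
  ring

omit [CharP F 2] in
theorem apply_one_zero_of_conj_unipotent {g : SpecialLinearGroup (Fin 2) F} {b c : Multiplicative F}
    (hb : b ≠ 1) (h : g * unipotent F b * g⁻¹ = unipotent F c) : g.1 1 0 = 0 := by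
  rw [mul_inv_eq_iff_eq_mul] at h
  have h11 := congrArg (fun g : SpecialLinearGroup (Fin 2) F ↦ g.1 1 1) h
  simp only [coe_mul, unipotent_apply, mul_apply, Fin.sum_univ_two, cons_val', cons_val_zero,
    cons_val_one, cons_val_fin_one, of_apply, zero_mul, one_mul, zero_add, mul_one,
    add_eq_right, mul_eq_zero] at h11
  exact h11.resolve_right hb

theorem sum_units_sq_mul [Fintype F] [Fintype Fˣ] {ψ : Multiplicative F →* ℂˣ} (hψ : ψ ≠ 1) {b : F}
    (hb : b ≠ 0) : ∑ p : Fˣ, (ψ (.ofAdd ((p : F) ^ 2 * b)) : ℂ) = -1 := by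
  classical
  have hbij : Function.Bijective fun a : F ↦ Multiplicative.ofAdd (a ^ 2 * b) := by
    refine (Fintype.bijective_iff_injective_and_card _).2 ⟨fun x y h ↦ ?_, by simp⟩
    exact CharTwo.sq_injective (mul_right_cancel₀ hb (Multiplicative.ofAdd.injective h))
  have hsum := (hbij.sum_comp fun h ↦ (ψ h : ℂ)).trans (sum_eq_zero_of_ne_one hψ)
  rw [Fintype.sum_eq_add_sum_subtype_ne _ 0, ← unitsEquivNeZero.sum_comp] at hsum
  simp only [ne_eq, OfNat.ofNat_ne_zero, not_false_eq_true, zero_pow, zero_mul, ofAdd_zero,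
    map_one, Units.val_one] at hsum
  exact eq_neg_of_add_eq_zero_right hsum

theorem inducedCharacter_unipotent [Fintype F] [Fintype (SpecialLinearGroup (Fin 2) F)]
    {ψ : Multiplicative F →* ℂˣ} (hψ : ψ ≠ 1) {b : Multiplicative F} (hb : b ≠ 1) :
    inducedCharacter (unipotent F) ψ (unipotent F b) = -1 := by
  classical
  have hcard : (Fintype.card (Multiplicative F) : ℂ) ≠ 0 := by simp
  rw [inducedCharacter, inv_mul_eq_iff_eq_mul₀ hcard]
  refine (Fintype.sum_of_injective _ (borelMap_injective (F := F))
    (fun x ↦ (ψ (.ofAdd ((x.1 : F) ^ 2 * b.toAdd)) : ℂ)) _ ?_ ?_).symm.trans ?_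
  · intro x hx
    exact Finset.sum_eq_zero fun h _ ↦ if_neg fun heq ↦
      hx (mem_range_borelMap (apply_one_zero_of_conj_unipotent hb heq))
  · exact fun x ↦ (sum_ite_conj_eq unipotent_injective ψ (borelMap_conj_unipotent x b.toAdd)).symm
  · rw [Fintype.sum_prod_type_right]
    simp [sum_units_sq_mul hψ (b := b.toAdd) hb]

end Matrix.SpecialLinearGroup
theorem sum_eq_sum_add_of_forall_ne {α β : Type*} [Fintype α] [AddCommGroup β] {f k : α → β}
    (a : α) (h : ∀ x, x ≠ a → f x = k x) : ∑ x, f x = ∑ x, k x + (f a - k a) := by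
  rw [← sub_eq_iff_eq_add', ← Finset.sum_sub_distrib]
  exact Fintype.sum_eq_single a fun x hx ↦ sub_eq_zero.2 (h x hx)

namespace Matrix.SpecialLinearGroup

variable {F : Type} [Field F] [CharP F 2] [Fintype F] [Fintype (SpecialLinearGroup (Fin 2) F)]
  [Fintype (torus F)]

/-- The virtual character `Ind ψ - Ind θ`, for `ψ` a character of the unipotent subgroup and `θ` a
character of the nonsplit torus. -/
noncomputable def discreteSeriesCharacter (ψ : Multiplicative F →* ℂˣ) (θ : torus F →* ℂˣ)
    (g : SpecialLinearGroup (Fin 2) F) : ℂ :=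
  inducedCharacter (unipotent F) ψ g - inducedCharacter (torus F).subtype θ g

variable {ψ : Multiplicative F →* ℂˣ} {θ : torus F →* ℂˣ}

theorem discreteSeriesCharacter_conj (x g : SpecialLinearGroup (Fin 2) F) :
    discreteSeriesCharacter ψ θ (x * g * x⁻¹) = discreteSeriesCharacter ψ θ g := by
  simp_rw [discreteSeriesCharacter, inducedCharacter_conj]

theorem discreteSeriesCharacter_one (hT : Nat.card (torus F) = Fintype.card F + 1) :
    discreteSeriesCharacter ψ θ 1 = Fintype.card F - 1 := by
  have hG := card_fin_two F
  have hq : (Fintype.card F : ℂ) ≠ 0 := by simp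
  have hq' : (Fintype.card F : ℂ) + 1 ≠ 0 := Nat.cast_add_one_ne_zero _
  rw [Nat.card_eq_fintype_card] at hT hG
  rw [discreteSeriesCharacter, inducedCharacter_one _ unipotent_injective,
    inducedCharacter_one _ (torus F).subtype_injective, hG, hT, Fintype.card_multiplicative]
  push_cast
  field_simp
  ring

theorem discreteSeriesCharacter_unipotent (hψ : ψ ≠ 1) {b : Multiplicative F} (hb : b ≠ 1) :
    discreteSeriesCharacter ψ θ (unipotent F b) = -1 := by
  rw [discreteSeriesCharacter, inducedCharacter_unipotent hψ hb,
    inducedCharacter_torus_of_unipotent _ hb, sub_zero]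

theorem discreteSeriesCharacter_torus {t : torus F} (ht : t ≠ 1) :
    discreteSeriesCharacter ψ θ t = -(θ t + θ t⁻¹) := by
  rw [discreteSeriesCharacter, inducedCharacter_torus _ ht,
    inducedCharacter_unipotent_of_mem_torus _ t.2 (by simpa using ht), zero_sub]

theorem sum_discreteSeriesCharacter_mul (f : SpecialLinearGroup (Fin 2) F → ℂ)
    (hf : ∀ x g, f (x * g * x⁻¹) = f g) :
    ∑ g, discreteSeriesCharacter ψ θ g * f g =
      Fintype.card (SpecialLinearGroup (Fin 2) F) *
        ((Fintype.card F : ℂ)⁻¹ * ∑ b, ψ b * f (unipotent F b) -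
          (Fintype.card (torus F) : ℂ)⁻¹ * ∑ t, θ t * f t) := by
  simp_rw [discreteSeriesCharacter, sub_mul, Finset.sum_sub_distrib]
  rw [sum_inducedCharacter_mul _ _ f hf, sum_inducedCharacter_mul _ _ f hf,
    Fintype.card_multiplicative, mul_sub]
  rfl

omit [CharP F 2] [Fintype (SpecialLinearGroup (Fin 2) F)] [Fintype (torus F)] in
theorem sum_unipotent_mul_of_eq (hψ : ψ ≠ 1) (f : SpecialLinearGroup (Fin 2) F → ℂ) (c : ℂ)
    (hf : ∀ b : Multiplicative F, b ≠ 1 → f (unipotent F b) = c) :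
    ∑ b, ψ b * f (unipotent F b) = f 1 - c := by
  rw [sum_eq_sum_add_of_forall_ne (k := fun b ↦ (ψ b : ℂ) * c) 1 fun b hb ↦ by rw [hf b hb],
    ← Finset.sum_mul, sum_eq_zero_of_ne_one hψ]
  simp

theorem sum_discreteSeriesCharacter_mul_inv (hT : Nat.card (torus F) = Fintype.card F + 1)
    (hψ : ψ ≠ 1) (hθ : θ ^ 2 ≠ 1) :
    ∑ g, discreteSeriesCharacter ψ θ g * discreteSeriesCharacter ψ θ g⁻¹ =
      Nat.card (SpecialLinearGroup (Fin 2) F) := by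
  have hone := discreteSeriesCharacter_one (ψ := ψ) (θ := θ) hT
  have hq : (Fintype.card F : ℂ) ≠ 0 := by simp
  have hU := sum_unipotent_mul_of_eq hψ (fun g ↦ discreteSeriesCharacter ψ θ g⁻¹) (-1)
    fun b hb ↦ by rw [← map_inv, discreteSeriesCharacter_unipotent hψ (inv_ne_one.2 hb)]
  have hTsum : ∑ t, (θ t : ℂ) * discreteSeriesCharacter ψ θ (t : SpecialLinearGroup (Fin 2) F)⁻¹ =
      0 := by
    rw [sum_eq_sum_add_of_forall_ne (k := fun t ↦ -(1 + ((θ ^ 2) t : ℂ))) 1,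
      Finset.sum_neg_distrib, Finset.sum_add_distrib, sum_eq_zero_of_ne_one hθ]
    · rw [Nat.card_eq_fintype_card] at hT
      simp [hone, hT]
      ring
    · intro t ht
      rw [← Subgroup.coe_inv, discreteSeriesCharacter_torus (inv_ne_one.2 ht), inv_inv]
      simp
      field_simp
  rw [sum_discreteSeriesCharacter_mul (fun g ↦ discreteSeriesCharacter ψ θ g⁻¹), hU, hTsum, inv_one,
    hone, Nat.card_eq_fintype_card]
  · field_simp
    ring
  · intro x g
    rw [← discreteSeriesCharacter_conj x g⁻¹]
    group

theorem sum_discreteSeriesCharacter_pow_three (hT : Nat.card (torus F) = Fintype.card F + 1)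
    (hψ : ψ ≠ 1) (hθ : θ ≠ 1) (hθ3 : θ ^ 3 = 1) :
    ∑ g, discreteSeriesCharacter ψ θ g ^ 3 = 0 := by
  have hone := discreteSeriesCharacter_one (ψ := ψ) (θ := θ) hT
  have hq : (Fintype.card F : ℂ) ≠ 0 := by simp
  have hq' : (Fintype.card F : ℂ) + 1 ≠ 0 := Nat.cast_add_one_ne_zero _
  rw [Nat.card_eq_fintype_card] at hT
  have hU := sum_unipotent_mul_of_eq hψ (fun g ↦ discreteSeriesCharacter ψ θ g ^ 2) 1
    fun b hb ↦ by rw [discreteSeriesCharacter_unipotent hψ hb]; norm_num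
  have hTsum : ∑ t, (θ t : ℂ) * discreteSeriesCharacter ψ θ (t : SpecialLinearGroup (Fin 2) F) ^ 2 =
      (Fintype.card F + 1) * (Fintype.card F - 2) := by
    have hθinv : θ⁻¹ ≠ 1 := fun h ↦ hθ <| MonoidHom.ext fun t ↦
      inv_eq_one.1 (DFunLike.congr_fun h t)
    rw [sum_eq_sum_add_of_forall_ne (k := fun t ↦ 1 + 2 * (θ t : ℂ) + (θ⁻¹ t : ℂ)) 1,
      Finset.sum_add_distrib, Finset.sum_add_distrib, ← Finset.mul_sum, sum_eq_zero_of_ne_one hθ,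
      sum_eq_zero_of_ne_one hθinv]
    · simp [hone, hT]
      ring
    · intro t ht
      have h3 : (θ t : ℂ) ^ 3 = 1 := by
        rw [← Units.val_pow_eq_pow_val]
        exact congrArg Units.val (DFunLike.congr_fun hθ3 t)
      rw [discreteSeriesCharacter_torus ht]
      simp
      field_simp
      linear_combination (θ t : ℂ) * h3
  simp_rw [pow_succ' _ 2]
  rw [sum_discreteSeriesCharacter_mul (fun g ↦ discreteSeriesCharacter ψ θ g ^ 2), hU, hTsum, hone,
    hT]
  · push_cast
    field_simp
    ring
  · intro x g
    rw [discreteSeriesCharacter_conj]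

theorem exists_simple_discreteSeriesCharacter_eq
    (hT : Nat.card (torus F) = Fintype.card F + 1) (hψ : ψ ≠ 1) (hθ : θ ^ 2 ≠ 1) :
    ∃ S : FDRep ℂ (SpecialLinearGroup (Fin 2) F), CategoryTheory.Simple S ∧
      discreteSeriesCharacter ψ θ = S.character := by
  have hq : 1 < Fintype.card F := Fintype.one_lt_card
  have hone := discreteSeriesCharacter_one (ψ := ψ) (θ := θ) hT
  have hnorm := sum_discreteSeriesCharacter_mul_inv hT hψ hθ
  unfold discreteSeriesCharacter at hone hnorm ⊢
  simp_rw [← character_inducedSubrepresentation] at hone hnorm ⊢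
  refine isIrreducibleCharacter_sub _ _ ?_ hnorm
  rw [Representation.char_one, Representation.char_one, sub_eq_iff_eq_add] at hone
  have hone' : (Module.finrank ℂ (inducedSubrepresentation (unipotent F) ψ).toSubmodule : ℂ) + 1 =
      Fintype.card F +
        Module.finrank ℂ (inducedSubrepresentation (torus F).subtype θ).toSubmodule := by
    rw [hone]
    ring
  have : Module.finrank ℂ (inducedSubrepresentation (unipotent F) ψ).toSubmodule + 1 =
      Fintype.card F +
        Module.finrank ℂ (inducedSubrepresentation (torus F).subtype θ).toSubmodule := by
    exact_mod_cast hone'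
  change Module.finrank ℂ (inducedSubrepresentation (torus F).subtype θ).toSubmodule <
    Module.finrank ℂ (inducedSubrepresentation (unipotent F) ψ).toSubmodule
  lia

end Matrix.SpecialLinearGroup

theorem two_pow_odd_mod_three (m : ℕ) : 2 ^ (2 * m + 1) % 3 = 2 := by
  rw [pow_succ, pow_mul, Nat.mul_mod, Nat.pow_mod]
  simp

/-- The polynomial `X ^ 2 + X + 1` has no root in a finite field of characteristic not three without
primitive cube roots of unity. -/
theorem sq_add_self_add_one_ne_zero {F : Type} [Field F] [Fintype F] (h3 : (3 : F) ≠ 0)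
    (hF : ¬ 3 ∣ Fintype.card F - 1) (r : F) : r ^ 2 + r + 1 ≠ 0 := by
  intro h
  have hr3 : r ^ 3 = 1 := by linear_combination (r - 1) * h
  have hr1 : r ≠ 1 := by
    rintro rfl
    apply h3
    linear_combination h
  have hr0 : r ≠ 0 := by
    rintro rfl
    simp at h
  have : Fact (Nat.Prime 3) := ⟨Nat.prime_three⟩
  rw [← orderOf_eq_prime hr3 hr1] at hF
  exact hF (orderOf_dvd_of_pow_eq_one (FiniteField.pow_card_sub_one_eq_one r hr0))

/-- For `q = 2^(2m+1) ≥ 8`, there is a non-trivial irreducible character `χ` of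
`SL₂(F_q) = PSL₂(q)` of degree `q - 1` whose cube does not contain the trivial character;
hence the character covering number is not `3`. -/
theorem psl2_even_cube_misses_trivial
    (q : ℕ) (hq8 : 8 ≤ q) (hq : ∃ m : ℕ, 1 ≤ m ∧ q = 2 ^ (2 * m + 1))
    (F : Type) [Field F] [Fintype F] (hF : Fintype.card F = q) :
    ∃ χ : Matrix.SpecialLinearGroup (Fin 2) F → ℂ,
      IsIrreducibleCharacter _ χ ∧ (χ ≠ fun _ => 1) ∧ χ 1 = (q : ℂ) - 1 ∧
      charInner (fun g => χ g ^ 3) (fun _ => 1) = 0 := by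
  obtain ⟨m, -, rfl⟩ := hq
  have : Fact (Nat.Prime 2) := ⟨Nat.prime_two⟩
  have : Fact (Nat.Prime 3) := ⟨Nat.prime_three⟩
  have : CharP F 2 := charP_of_card_eq_prime_pow hF
  have hmod := two_pow_odd_mod_three m
  have h3 : (3 : F) ≠ 0 := by
    have h2 : (2 : F) = 0 := CharTwo.two_eq_zero
    intro h
    exact one_ne_zero (by linear_combination h - h2)
  have hT := Matrix.SpecialLinearGroup.card_torus
    (sq_add_self_add_one_ne_zero h3 (by rw [hF]; lia))
  let _ : Fintype (Matrix.SpecialLinearGroup (Fin 2) F) := Fintype.ofFinite _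
  let _ : Fintype (Matrix.SpecialLinearGroup.torus F) := Fintype.ofFinite _
  let _ : CommGroup (Matrix.SpecialLinearGroup.torus F) :=
    { mul_comm := Std.Commutative.comm }
  obtain ⟨ψ, hψ⟩ := exists_orderOf_eq_of_dvd_card (H := Multiplicative F) 2 (by
    rw [Nat.card_eq_fintype_card, Fintype.card_multiplicative, hF]
    exact dvd_pow_self 2 (by lia))
  obtain ⟨θ, hθ⟩ := exists_orderOf_eq_of_dvd_card (H := Matrix.SpecialLinearGroup.torus F) 3
    (by rw [hT, hF]; lia)
  have hψ1 : ψ ≠ 1 := by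
    rintro rfl
    simp at hψ
  have hθ1 : θ ≠ 1 := by
    rintro rfl
    simp at hθ
  have hθ2 : θ ^ 2 ≠ 1 := fun h ↦ by
    have := orderOf_dvd_of_pow_eq_one h
    rw [hθ] at this
    lia
  have hθ3 : θ ^ 3 = 1 := hθ ▸ pow_orderOf_eq_one θ
  have hone := Matrix.SpecialLinearGroup.discreteSeriesCharacter_one (ψ := ψ) (θ := θ) hT
  rw [hF] at hone
  refine ⟨Matrix.SpecialLinearGroup.discreteSeriesCharacter ψ θ,
    Matrix.SpecialLinearGroup.exists_simple_discreteSeriesCharacter_eq hT hψ1 hθ2,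
    fun h ↦ ?_, hone, ?_⟩
  · rw [h, eq_sub_iff_add_eq] at hone
    have : 1 + 1 = 2 ^ (2 * m + 1) := by
      beta_reduce at hone
      exact_mod_cast hone
    lia
  · have hsum :=
      Matrix.SpecialLinearGroup.sum_discreteSeriesCharacter_pow_three hT hψ1 hθ1 hθ3
    simp only [charInner, map_one, mul_one]
    rw [hsum, mul_zero]
end

section
/- Let q ≥ 8 be a power of 2 and G = SL₂(F_q). If χ is an irreducible complex character of G of degree q − 1 and ψ is an irreducible complex character of G of degree q, then ⟨χ², ψ⟩ = 0. In particular, c(χ²) ≠ Irr(G). -/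
open scoped BigOperators

namespace SL2

open Matrix Matrix.SpecialLinearGroup

variable {F : Type*} [Field F]

/-- The matrix of determinant one with the given entries. -/
def ofEntries (a b c d : F) (h : a * d - b * c = 1) : SpecialLinearGroup (Fin 2) F :=
  ⟨!![a, b; c, d], by rw [det_fin_two_of, h]⟩

@[simp]
lemma coe_ofEntries (a b c d : F) (h : a * d - b * c = 1) :
    (ofEntries a b c d h : Matrix (Fin 2) (Fin 2) F) = !![a, b; c, d] := rfl

/-- The upper unitriangular matrices, as a homomorphism from the additive group of `F`. -/
def upper : Multiplicative F →* SpecialLinearGroup (Fin 2) F where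
  toFun x := ofEntries 1 x.toAdd 0 1 (by simp)
  map_one' := by ext i j; fin_cases i <;> fin_cases j <;> simp
  map_mul' x y := by
    ext i j; fin_cases i <;> fin_cases j <;> simp [add_comm]

/-- The diagonal matrices, as a homomorphism from the multiplicative group of `F`. -/
def torus : Fˣ →* SpecialLinearGroup (Fin 2) F where
  toFun s := ofEntries s 0 0 (s⁻¹ : Fˣ) (by simp)
  map_one' := by ext i j; fin_cases i <;> fin_cases j <;> simp
  map_mul' x y := by
    ext i j; fin_cases i <;> fin_cases j <;> simp [mul_comm]

@[simp]
lemma coe_upper (x : Multiplicative F) :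
    (upper x : Matrix (Fin 2) (Fin 2) F) = !![1, x.toAdd; 0, 1] := rfl

@[simp]
lemma coe_torus (s : Fˣ) :
    (torus s : Matrix (Fin 2) (Fin 2) F) = !![(s : F), 0; 0, ((s⁻¹ : Fˣ) : F)] := rfl

variable (F) in
/-- The subgroup of upper triangular matrices. -/
def borel : Subgroup (SpecialLinearGroup (Fin 2) F) where
  carrier := {g | g 1 0 = 0}
  mul_mem' {a b} ha hb := by
    simp only [Set.mem_ofPred_eq] at *
    simp [Matrix.mul_apply, Fin.sum_univ_two, ha, hb]
  one_mem' := by simp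
  inv_mem' {a} ha := by
    simp only [Set.mem_ofPred_eq] at *
    simp [adjugate_fin_two, ha]

lemma mem_borel {g : SpecialLinearGroup (Fin 2) F} : g ∈ borel F ↔ g 1 0 = 0 := Iff.rfl

lemma det_eq (g : SpecialLinearGroup (Fin 2) F) : g 0 0 * g 1 1 - g 0 1 * g 1 0 = 1 := by
  rw [← det_fin_two, g.det_coe]

/-- An upper triangular matrix is uniquely a diagonal matrix times a unitriangular one. -/
noncomputable def borelEquiv : Fˣ × Multiplicative F ≃ borel F :=
  Equiv.ofBijective (fun p ↦ ⟨torus p.1 * upper p.2, by simp [mem_borel]⟩) <| by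
    constructor
    · rintro ⟨s, x⟩ ⟨t, y⟩ h
      have h' := congrArg (fun b : borel F ↦ (b : SpecialLinearGroup (Fin 2) F).1) h
      have h00 := congrFun (congrFun h' 0) 0
      have h01 := congrFun (congrFun h' 0) 1
      simp at h00 h01
      obtain rfl := Units.ext h00
      simpa using h01
    · rintro ⟨g, hg⟩
      have hd := det_eq g
      rw [mem_borel] at hg
      rw [hg, mul_zero, sub_zero] at hd
      have h0 : g 0 0 ≠ 0 := left_ne_zero_of_mul_eq_one hd
      refine ⟨(Units.mk0 _ h0, .ofAdd ((g 0 0)⁻¹ * g 0 1)), Subtype.ext ?_⟩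
      ext i j
      fin_cases i <;> fin_cases j <;> simp [h0, hg]
      exact inv_eq_of_mul_eq_one_right hd

lemma coe_borelEquiv (p : Fˣ × Multiplicative F) :
    (borelEquiv p : SpecialLinearGroup (Fin 2) F) = torus p.1 * upper p.2 := rfl

/-- A matrix outside `borel F` is determined by its diagonal and its nonzero lower left entry. -/
noncomputable def complBorelEquiv :
    {g : SpecialLinearGroup (Fin 2) F // g ∉ borel F} ≃ Fˣ × F × F where
  toFun g := (Units.mk0 (g.1 1 0) g.2, g.1 0 0, g.1 1 1)
  invFun p := ⟨ofEntries p.2.1 ((p.2.1 * p.2.2 - 1) * (p.1⁻¹ : Fˣ)) p.1 p.2.2 (by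
    simp), by simp [mem_borel]⟩
  left_inv := by
    rintro ⟨g, hg⟩
    have hd := det_eq g
    rw [mem_borel] at hg
    ext i j
    fin_cases i <;> fin_cases j <;> simp
    · exact (mul_inv_eq_iff_eq_mul₀ hg).2 (by linear_combination hd)
    · rfl
  right_inv := by
    rintro ⟨s, x, y⟩
    ext <;> simp

section Finite

variable [Fintype F]

lemma natCard_borel : Nat.card (borel F) = (Fintype.card F - 1) * Fintype.card F := by
  classical
  rw [← Nat.card_congr borelEquiv, Nat.card_prod, Nat.card_eq_fintype_card, Fintype.card_units,
    Nat.card_congr Multiplicative.toAdd, Nat.card_eq_fintype_card]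

lemma natCard_eq : Nat.card (SpecialLinearGroup (Fin 2) F) =
    Nat.card (borel F) + (Fintype.card F - 1) * Fintype.card F ^ 2 := by
  classical
  rw [← Nat.card_congr (Equiv.sumCompl (· ∈ borel F)), Nat.card_sum,
    Nat.card_congr complBorelEquiv]
  simp [Fintype.card_units, sq]

lemma natCard_borel_inter_conj {h : SpecialLinearGroup (Fin 2) F} (hh : h ∉ borel F) :
    Nat.card {b : borel F // h⁻¹ * b * h ∈ borel F} = Fintype.card F - 1 := by
  classical
  rw [mem_borel] at hh
  have key (p : Fˣ × Multiplicative F) : h⁻¹ * (borelEquiv p : SpecialLinearGroup (Fin 2) F) * h ∈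
      borel F ↔ p.2.toAdd = ((p.1⁻¹ : Fˣ) * (p.1⁻¹ : Fˣ) - 1) * h 0 0 / h 1 0 := by
    rw [eq_div_iff hh]
    have hs := p.1.mul_inv
    have : (h⁻¹ * (borelEquiv p : SpecialLinearGroup (Fin 2) F) * h) 1 0 =
        h 1 0 * p.1 * (((p.1⁻¹ : Fˣ) * (p.1⁻¹ : Fˣ) - 1) * h 0 0 - p.2.toAdd * h 1 0) := by
      simp [coe_borelEquiv, adjugate_fin_two, Matrix.mul_apply, Fin.sum_univ_two]
      field_simp
      ring
    rw [mem_borel, this]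
    simp only [mul_eq_zero, hh, Units.ne_zero, false_or, sub_eq_zero]
    exact eq_comm
  rw [← Fintype.card_units, ← Nat.card_eq_fintype_card]
  refine (Nat.card_eq_of_bijective (fun s : Fˣ ↦ ⟨borelEquiv (s, .ofAdd
    (((s⁻¹ : Fˣ) * (s⁻¹ : Fˣ) - 1) * h 0 0 / h 1 0)), (key _).2 rfl⟩) ⟨?_, ?_⟩).symm
  · intro s t hst
    exact congrArg Prod.fst (borelEquiv.injective (congrArg Subtype.val hst))
  · rintro ⟨b, hb⟩
    obtain ⟨⟨s, x⟩, rfl⟩ := borelEquiv.surjective b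
    refine ⟨s, Subtype.ext ?_⟩
    have := (key _).1 hb
    simp only at this
    simp only [← this, ofAdd_toAdd]

end Finite

lemma isConj_inv [CharP F 2] (g : SpecialLinearGroup (Fin 2) F) : IsConj g g⁻¹ := by
  have h2 : (2 : F) = 0 := CharTwo.two_eq_zero
  suffices ∃ x y z : F, x * x - y * z = 1 ∧ x * (g 0 0 + g 1 1) + y * g 1 0 + z * g 0 1 = 0 by
    obtain ⟨x, y, z, hdet, htr⟩ := this
    refine isConj_iff.2 ⟨ofEntries x y z x hdet, ?_⟩
    rw [mul_inv_eq_iff_eq_mul]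
    ext i j
    fin_cases i <;> fin_cases j <;>
      simp [adjugate_fin_two, Matrix.mul_apply, Fin.sum_univ_two]
    · linear_combination htr - (x * g 1 1) * h2
    · linear_combination (x * g 0 1) * h2
    · linear_combination (x * g 1 0) * h2
    · linear_combination htr - (x * g 0 0) * h2
  by_cases hb : g 0 1 = 0
  · by_cases hc : g 1 0 = 0
    · exact ⟨0, 1, 1, by linear_combination -h2, by simp [hb, hc]⟩
    · exact ⟨1, -(g 0 0 + g 1 1) / g 1 0, 0, by simp, by field_simp; ring⟩
  · exact ⟨1, 0, -(g 0 0 + g 1 1) / g 0 1, by simp, by field_simp; ring⟩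

lemma isConj_upper_of_sq (s : Fˣ) (x : F) :
    IsConj (upper (.ofAdd x)) (upper (.ofAdd (s ^ 2 * x))) := by
  refine isConj_iff.2 ⟨torus s, ?_⟩
  rw [mul_inv_eq_iff_eq_mul]
  ext i j
  fin_cases i <;> fin_cases j <;> simp
  field_simp

lemma isConj_torus_mul_upper {s : Fˣ} (hs : (s : F) ^ 2 ≠ 1) (x : Multiplicative F) :
    IsConj (torus s) (torus s * upper x) := by
  refine isConj_iff.2 ⟨upper (.ofAdd (s ^ 2 * x.toAdd / (1 - s ^ 2))), ?_⟩
  rw [mul_inv_eq_iff_eq_mul]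
  have := sub_ne_zero.2 hs.symm
  ext i j
  fin_cases i <;> fin_cases j <;> simp
  field_simp
  ring

lemma isConj_torus_inv (s : Fˣ) : IsConj (torus s) (torus s⁻¹) := by
  refine isConj_iff.2 ⟨ofEntries 0 1 (-1) 0 (by simp), ?_⟩
  rw [mul_inv_eq_iff_eq_mul]
  ext i j
  fin_cases i <;> fin_cases j <;> simp

/-- A normal subgroup of `SL₂(F)` containing the upper unitriangular matrices is everything. -/
lemma eq_top_of_upper_mem {N : Subgroup (SpecialLinearGroup (Fin 2) F)} [hN : N.Normal]
    (hU : ∀ x, upper x ∈ N) : N = ⊤ := by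
  have hL (c : F) : ofEntries 1 0 c 1 (by simp) ∈ N := by
    convert hN.conj_mem _ (hU (.ofAdd (-c))) (ofEntries 0 1 (-1) 0 (by simp))
    rw [eq_mul_inv_iff_mul_eq]
    ext i j
    fin_cases i <;> fin_cases j <;> simp
  have hC (g : SpecialLinearGroup (Fin 2) F) (hg : g 1 0 ≠ 0) : g ∈ N := by
    convert N.mul_mem (N.mul_mem (hU (.ofAdd ((g 0 0 - 1) / g 1 0))) (hL (g 1 0)))
      (hU (.ofAdd ((g 1 1 - 1) / g 1 0)))
    have := det_eq g
    ext i j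
    fin_cases i <;> fin_cases j <;> simp [hg]
    · field_simp
      linear_combination -this
    · field_simp
      ring
  refine eq_top_iff.2 fun g _ ↦ ?_
  by_cases hg : g 1 0 = 0
  · refine (N.mul_mem_cancel_left (hL 1)).1 (hC _ ?_)
    have := det_eq g
    simp [Matrix.mul_apply, Fin.sum_univ_two, hg] at this ⊢
    exact left_ne_zero_of_mul_eq_one this
  · exact hC g hg

end SL2

namespace Subgroup

variable {G : Type*} [Group G] (B : Subgroup G)

/-- The permutation character of `G` on the cosets of `B`. -/
noncomputable def permChar (g : G) : ℂ :=
  (Nat.card {h : G // h⁻¹ * g * h ∈ B} : ℂ) / Nat.card B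

lemma conj_permChar (g : G) : (starRingEnd ℂ) (B.permChar g) = B.permChar g := by
  simp [permChar]

lemma permChar_conj (g h : G) : B.permChar (h * g * h⁻¹) = B.permChar g := by
  unfold permChar
  congr 2
  refine Nat.card_congr ((Equiv.mulLeft h⁻¹).subtypeEquiv fun k ↦ ?_)
  simp [mul_assoc]

variable [Fintype G]

open scoped Classical in
lemma natCard_conj_mem_eq_sum (g : G) : (Nat.card {h : G // h⁻¹ * g * h ∈ B} : ℂ) =
    ∑ h : G, if h⁻¹ * g * h ∈ B then 1 else 0 := by
  rw [Nat.card_eq_fintype_card, Fintype.card_subtype]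
  simp

open scoped Classical in
/-- Frobenius reciprocity for the trivial character of `B`. -/
lemma sum_mul_permChar [Fintype B] (f : G → ℂ) (hf : ∀ g h, f (h * g * h⁻¹) = f g) :
    ∑ g, f g * B.permChar g = Nat.card G / Nat.card B * ∑ b : B, f b := by
  have hconj (h : G) : ∑ g, f g * (if h⁻¹ * g * h ∈ B then 1 else 0) = ∑ b : B, f b := by
    rw [← (MulAut.conj h).toEquiv.sum_comp]
    simp only [MulEquiv.toEquiv_eq_coe, EquivLike.coe_coe, MulAut.conj_apply, hf]
    simp only [mul_assoc, inv_mul_cancel_left, inv_mul_cancel, mul_one, mul_ite, mul_zero]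
    rw [← Finset.sum_filter]
    exact Finset.sum_subtype _ (by simp) f
  simp only [permChar, mul_div_assoc', ← Finset.sum_div, natCard_conj_mem_eq_sum, Finset.mul_sum]
  rw [Finset.sum_comm]
  simp only [hconj, Finset.sum_const, Finset.card_univ, nsmul_eq_mul, Nat.card_eq_fintype_card]
  rw [← Finset.mul_sum]
  ring

open scoped Classical in
lemma sum_permChar_of_card_inter_conj [Fintype B] {m : ℕ}
    (hm : ∀ h ∉ B, Nat.card {b : B // h⁻¹ * b * h ∈ B} = m) :
    ∑ b : B, B.permChar b =
      (Nat.card B * Nat.card B + (Nat.card G - Nat.card B) * m) / Nat.card B := by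
  have hinter (h : G) : ∑ b : B, (if h⁻¹ * b * h ∈ B then 1 else 0 : ℂ) =
      m + if h ∈ B then (Nat.card B - m : ℂ) else 0 := by
    by_cases hh : h ∈ B
    · simp [hh, B.mul_mem_cancel_right hh, B.mul_mem_cancel_left (B.inv_mem hh),
        Nat.card_eq_fintype_card]
    · rw [← hm h hh, Nat.card_eq_fintype_card, Fintype.card_subtype]
      simp [hh]
  simp only [permChar, ← Finset.sum_div, natCard_conj_mem_eq_sum]
  rw [Finset.sum_comm]
  simp only [hinter, Finset.sum_add_distrib, ← Finset.sum_filter, Finset.sum_const,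
    ← Fintype.card_subtype, Finset.card_univ, nsmul_eq_mul, Nat.card_eq_fintype_card]
  congr 1
  have : Fintype.card {x // x ∈ B} = Fintype.card B := rfl
  ring

end Subgroup

namespace Representation

open Module

variable {G V : Type*} [Group G] [AddCommGroup V] [Module ℂ V]
  (ρ : Representation ℂ G V)

variable {A : Type*} [Group A] [Fintype A] [Invertible (Fintype.card A : ℂ)] (u : A →* G)

lemma averageMap_comp_eq :
    averageMap (ρ.comp u) = (Fintype.card A : ℂ)⁻¹ • ∑ x, ρ (u x) := by
  simp [averageMap, GroupAlgebra.average]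

lemma trace_mul_averageMap_comp (t : G) :
    LinearMap.trace ℂ V (ρ t * averageMap (ρ.comp u)) =
      (Fintype.card A : ℂ)⁻¹ * ∑ x, ρ.character (t * u x) := by
  rw [averageMap_comp_eq]
  simp [Finset.mul_sum, character]

/-- If the invariants of a subgroup form a line, an element normalising the subgroup acts on this
line by a scalar. -/
lemma exists_mul_averageMap_eq_smul (hfix : finrank ℂ (invariants (ρ.comp u)) = 1) {t : G}
    (ht : ∀ x, ∃ y, u x * t = t * u y) :
    ∃ c : ℂ, ρ t * averageMap (ρ.comp u) = c • averageMap (ρ.comp u) := by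
  obtain ⟨w, hw, hspan⟩ := finrank_eq_one_iff'.1 hfix
  have hmap (v : V) (hv : v ∈ invariants (ρ.comp u)) : ρ t v ∈ invariants (ρ.comp u) := by
    intro x
    obtain ⟨y, hy⟩ := ht x
    change ρ (u x) (ρ t v) = _
    rw [← Module.End.mul_apply, ← map_mul, hy, map_mul, Module.End.mul_apply]
    exact congrArg (ρ t) (hv y)
  obtain ⟨c, hc⟩ := hspan ⟨ρ t w, hmap w w.2⟩
  refine ⟨c, LinearMap.ext fun v ↦ ?_⟩
  obtain ⟨d, hd⟩ := hspan ⟨_, averageMap_invariant (ρ.comp u) v⟩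
  have hc' : c • (w : V) = ρ t w := congrArg Subtype.val hc
  have hd' : d • (w : V) = averageMap (ρ.comp u) v := congrArg Subtype.val hd
  rw [Module.End.mul_apply, LinearMap.smul_apply, ← hd', map_smul, ← hc', smul_comm]

variable [FiniteDimensional ℂ V]

open scoped ComplexOrder in
lemma character_inv_eq_conj [Finite G] (g : G) :
    ρ.character g⁻¹ = (starRingEnd ℂ) (ρ.character g) := by
  classical
  have := Fintype.ofFinite G
  let b := finBasis ℂ V
  let A (h : G) : Matrix (Fin (finrank ℂ V)) (Fin (finrank ℂ V)) ℂ := LinearMap.toMatrix b b (ρ h)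
  have hA (h k : G) : A (h * k) = A h * A k := by
    simp only [A, map_mul, Module.End.mul_eq_comp, LinearMap.toMatrix_comp b b b]
  have hA1 : A 1 = 1 := by simp [A]
  have hchar (h : G) : ρ.character h = (A h).trace :=
    (LinearMap.trace_eq_matrix_trace ℂ b (ρ h))
  let M := ∑ h : G, (A h).conjTranspose * A h
  have hM : M.PosDef := by
    simp only [M]
    rw [← Finset.add_sum_erase _ _ (Finset.mem_univ (1 : G))]
    refine Matrix.PosDef.add_posSemidef (by simpa [hA1] using Matrix.PosDef.one) ?_
    exact Matrix.posSemidef_sum _ fun h _ ↦ Matrix.posSemidef_conjTranspose_mul_self _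
  have hdet : IsUnit M.det := hM.isUnit.map Matrix.detMonoidHom
  have hinv : (A g).conjTranspose * M = M * A g⁻¹ := by
    simp only [M, Finset.mul_sum, Finset.sum_mul]
    rw [← Equiv.sum_comp (Equiv.mulRight g) (fun h ↦ (A h).conjTranspose * A h * A g⁻¹)]
    refine Finset.sum_congr rfl fun h _ ↦ ?_
    rw [mul_assoc, ← hA, Equiv.coe_mulRight, mul_inv_cancel_right, hA, Matrix.conjTranspose_mul,
      mul_assoc]
  have : A g⁻¹ = M⁻¹ * ((A g).conjTranspose * M) := by
    rw [hinv, ← mul_assoc, Matrix.nonsing_inv_mul _ hdet, one_mul]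
  rw [hchar, hchar, this, Matrix.trace_mul_comm, mul_assoc, Matrix.mul_nonsing_inv _ hdet,
    mul_one, Matrix.trace_conjTranspose]
  rfl

lemma exists_int_eq_character_of_mul_self_eq_one {g : G} (hg : g * g = 1) :
    ∃ m : ℤ, ρ.character g = m := by
  have hρ : ρ g * ρ g = 1 := by rw [← map_mul, hg, map_one]
  have he : IsIdempotentElem ((2⁻¹ : ℂ) • (1 + ρ g)) := by
    rw [IsIdempotentElem, smul_mul_smul_comm, mul_add, add_mul, add_mul, hρ]
    simp only [one_mul, mul_one]
    module
  have ht := (LinearMap.IsIdempotentElem.isProj_range _ he).trace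
  rw [map_smul, map_add, LinearMap.trace_one, smul_eq_mul] at ht
  refine ⟨2 * finrank ℂ (LinearMap.range ((2⁻¹ : ℂ) • (1 + ρ g))) - finrank ℂ V, ?_⟩
  push_cast
  rw [← ht]
  simp only [character]
  ring

lemma sum_character_comp :
    ∑ x, ρ.character (u x) = Fintype.card A * finrank ℂ (invariants (ρ.comp u)) := by
  have h := trace_mul_averageMap_comp ρ u 1
  have h0 : (Fintype.card A : ℂ) ≠ 0 := Invertible.ne_zero _
  rw [map_one, one_mul, (isProj_averageMap _).trace] at h
  simp only [one_mul] at h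
  rw [h, mul_inv_cancel_left₀ h0]

lemma sum_character_mul_comp_eq_zero (hfix : finrank ℂ (invariants (ρ.comp u)) = 0) (t : G) :
    ∑ x, ρ.character (t * u x) = 0 := by
  have h0 : (Fintype.card A : ℂ) ≠ 0 := Invertible.ne_zero _
  have hE : averageMap (ρ.comp u) = 0 := by
    ext v
    have := averageMap_invariant (ρ.comp u) v
    rw [Submodule.finrank_eq_zero.1 hfix] at this
    exact this
  have := trace_mul_averageMap_comp ρ u t
  rw [hE, mul_zero, map_zero, eq_comm] at this
  simpa [h0] using this

end Representation

namespace FDRep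

open CategoryTheory

variable {G : Type} [Group G] [Fintype G]

lemma sum_character_eq_zero (W : FDRep ℂ G) [Simple W] (hW : W.character 1 ≠ 1) :
    ∑ g, W.character g = 0 := by
  have : NeZero (Nat.card G : ℂ) := ⟨by simp⟩
  have hinv := invertibleOfNonzero (NeZero.ne (Nat.card G : ℂ))
  let T : FDRep ℂ G := FDRep.of (Representation.trivial ℂ G ℂ)
  have hT (g : G) : T.character g = 1 := by
    simp [T, character, Representation.trivial]
  have : Simple T := by
    rw [simple_iff_char_is_norm_one]
    simp [hT]
  have h := char_orthonormal W T
  rw [if_neg fun ⟨i⟩ ↦ hW (by rw [char_iso i, hT])] at h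
  simpa [hT] using h

lemma sum_character_mul_character_inv (W : FDRep ℂ G) [hW : Simple W] :
    ∑ g, W.character g * W.character g⁻¹ = Nat.card G := by
  have : NeZero (Nat.card G : ℂ) := ⟨by simp⟩
  exact (simple_iff_char_is_norm_one W).1 hW

lemma exists_ρ_ne_one (W : FDRep ℂ G) [Simple W] (hW : W.character 1 ≠ 1) : ∃ g, W.ρ g ≠ 1 := by
  by_contra! h
  have hconst (g : G) : W.character g = W.character 1 := by simp only [character, h]
  have h0 := W.sum_character_eq_zero hW
  have h1 := W.sum_character_mul_character_inv
  simp only [hconst, Finset.sum_const, Finset.card_univ, nsmul_eq_mul] at h0 h1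
  rw [← mul_assoc, h0, zero_mul] at h1
  exact Nat.cast_ne_zero.2 Nat.card_pos.ne' h1.symm

end FDRep

namespace SL2

open Module Representation Matrix.SpecialLinearGroup

variable {F : Type} [Field F]

section Representation

lemma sq_ne_one [CharP F 2] {s : Fˣ} (hs : s ≠ 1) : (s : F) ^ 2 ≠ 1 := fun h ↦ by
  refine hs (Units.ext (sub_eq_zero.1 (pow_eq_zero_iff two_ne_zero |>.1 ?_)))
  rw [sub_pow_char, h]
  simp

variable {V : Type*} [AddCommGroup V] [Module ℂ V]
  (ρ : Representation ℂ (Matrix.SpecialLinearGroup (Fin 2) F) V)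

lemma character_eq_of_isConj {g h : Matrix.SpecialLinearGroup (Fin 2) F} (hgh : IsConj g h) :
    ρ.character h = ρ.character g := by
  obtain ⟨k, rfl⟩ := isConj_iff.1 hgh
  exact ρ.char_conj g k

lemma character_torus_mul_upper [CharP F 2] {s : Fˣ} (hs : s ≠ 1) (x : Multiplicative F) :
    ρ.character (torus s * upper x) = ρ.character (torus s) :=
  character_eq_of_isConj ρ (isConj_torus_mul_upper (sq_ne_one hs) x)

lemma character_inv [CharP F 2] (g : Matrix.SpecialLinearGroup (Fin 2) F) :
    ρ.character g⁻¹ = ρ.character g :=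
  character_eq_of_isConj ρ (isConj_inv g)

variable [FiniteDimensional ℂ V]

lemma finrank_invariants_upper_lt (hρ : ∃ g, ρ g ≠ 1) :
    finrank ℂ (invariants (ρ.comp upper)) < finrank ℂ V := by
  refine lt_of_le_of_ne (Submodule.finrank_le _) fun h ↦ ?_
  have htop := Submodule.eq_top_of_finrank_eq h
  obtain ⟨g, hg⟩ := hρ
  have hker : MonoidHom.ker ρ = ⊤ := eq_top_of_upper_mem fun x ↦ LinearMap.ext fun v ↦ by
    have hv : v ∈ invariants (ρ.comp upper) := htop ▸ Submodule.mem_top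
    exact hv x
  exact hg (MonoidHom.mem_ker.1 (hker ▸ Subgroup.mem_top g))

variable [Fintype F] [CharP F 2]

lemma isConj_upper {x : Multiplicative F} (hx : x ≠ 1) : IsConj (upper (.ofAdd 1)) (upper x) := by
  obtain ⟨s, hs⟩ := FiniteField.isSquare_of_char_two (ringChar.eq F 2) x.toAdd
  have hs0 : s ≠ 0 := by
    rintro rfl
    exact hx (by simpa using hs)
  have := isConj_upper_of_sq (Units.mk0 s hs0) 1
  rwa [mul_one, Units.val_mk0, sq, ← hs, ofAdd_toAdd] at this

lemma exists_character_upper : ∃ m : ℤ, (∀ x ≠ 1, ρ.character (upper x) = m) ∧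
    finrank ℂ V + (Fintype.card F - 1) * m =
      (Fintype.card F * finrank ℂ (invariants (ρ.comp upper)) : ℤ) := by
  classical
  obtain ⟨m, hm⟩ := ρ.exists_int_eq_character_of_mul_self_eq_one
    (g := upper (.ofAdd (1 : F))) (by
      rw [← map_mul, ← ofAdd_add, CharTwo.add_self_eq_zero, ofAdd_zero, map_one])
  have hU (x : Multiplicative F) (hx : x ≠ 1) : ρ.character (upper x) = m := by
    rw [character_eq_of_isConj ρ (isConj_upper hx), hm]
  refine ⟨m, hU, ?_⟩
  have : Invertible (Fintype.card (Multiplicative F) : ℂ) := invertibleOfNonzero (by simp)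
  have h := sum_character_comp ρ (upper (F := F))
  rw [← Finset.add_sum_erase _ _ (Finset.mem_univ 1), map_one, char_one,
    Finset.sum_congr rfl fun x hx ↦ hU x (Finset.ne_of_mem_erase hx)] at h
  have hF : 1 ≤ Fintype.card F := Fintype.card_pos
  simp [Finset.card_erase_of_mem, Nat.cast_sub hF] at h
  exact_mod_cast h

/-- The values on the Borel subgroup of a nontrivial character of degree `q - 1`. -/
lemma character_borel_of_finrank_add_one (hρ : ∃ g, ρ g ≠ 1)
    (hd : finrank ℂ V + 1 = Fintype.card F) :
    (∀ x ≠ 1, ρ.character (upper x) = -1) ∧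
      ∀ s ≠ 1, ∀ x, ρ.character (torus s * upper x) = 0 := by
  obtain ⟨m, hU, hm⟩ := exists_character_upper ρ
  have hlt := finrank_invariants_upper_lt ρ hρ
  set a := finrank ℂ (invariants (ρ.comp upper)) with ha
  have hdvd : finrank ℂ V ∣ a := by
    zify
    exact ⟨1 + m - a, by rw [← hd] at hm; push_cast at hm; linear_combination -hm⟩
  have ha0 : a = 0 := Nat.eq_zero_of_dvd_of_lt hdvd hlt
  have hm1 : m = -1 := by
    rw [ha0, ← hd] at hm
    push_cast at hm
    have : (finrank ℂ V : ℤ) * (m + 1) = 0 := by linear_combination hm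
    rcases mul_eq_zero.1 this with h | h <;> omega
  refine ⟨fun x hx ↦ by rw [hU x hx, hm1]; simp, fun s hs x ↦ ?_⟩
  have : Invertible (Fintype.card (Multiplicative F) : ℂ) := invertibleOfNonzero (by simp)
  have h := sum_character_mul_comp_eq_zero ρ upper ha0 (torus s)
  simp only [character_torus_mul_upper ρ hs] at h
  rw [character_torus_mul_upper ρ hs]
  simpa using h

/-- The values on the Borel subgroup of a nontrivial character of degree `q`. -/
lemma character_borel_of_finrank (hq : 4 ≤ Fintype.card F) (hρ : ∃ g, ρ g ≠ 1)
    (hd : finrank ℂ V = Fintype.card F) :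
    (∀ x ≠ 1, ρ.character (upper x) = 0) ∧
      ∀ s ≠ 1, ∀ x, ρ.character (torus s * upper x) = 1 := by
  classical
  obtain ⟨m, hU, hm⟩ := exists_character_upper ρ
  have hlt := finrank_invariants_upper_lt ρ hρ
  set a := finrank ℂ (invariants (ρ.comp upper)) with ha
  rw [hd] at hm hlt
  have ha1 : a = 1 := by
    have hdvd : (Fintype.card F - 1 : ℤ) ∣ a - 1 := ⟨1 + m - a, by linear_combination -hm⟩
    obtain ⟨k, hk⟩ := hdvd
    have hk0 : k = 0 := by
      have h1 : k < 1 := by nlinarith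
      have h2 : -1 < k := by nlinarith
      omega
    rw [hk0] at hk
    omega
  have hm0 : m = 0 := by
    rw [ha1] at hm
    have : (Fintype.card F - 1 : ℤ) * m = 0 := by linear_combination hm
    rcases mul_eq_zero.1 this with h | h <;> omega
  refine ⟨fun x hx ↦ by rw [hU x hx, hm0]; simp, fun s hs x ↦ ?_⟩
  have : Invertible (Fintype.card (Multiplicative F) : ℂ) := invertibleOfNonzero (by simp)
  have hnorm (x : Multiplicative F) : ∃ y, upper x * torus s = torus s * upper y := by
    refine ⟨.ofAdd (((s⁻¹ : Fˣ) : F) ^ 2 * x.toAdd), ?_⟩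
    ext i j
    fin_cases i <;> fin_cases j <;> simp
    field_simp
  obtain ⟨c, hc⟩ := exists_mul_averageMap_eq_smul ρ upper ha1 hnorm
  set E := averageMap (ρ.comp upper)
  have hE1 : LinearMap.trace ℂ V E = 1 := by
    rw [(isProj_averageMap _).trace, ← ha, ha1, Nat.cast_one]
  have htr {t : Fˣ} (ht : t ≠ 1) :
      LinearMap.trace ℂ V (ρ (torus t) * E) = ρ.character (torus t) := by
    rw [trace_mul_averageMap_comp]
    simp [character_torus_mul_upper ρ ht]
  have hsc : ρ.character (torus s) = c := by
    rw [← htr hs, hc, map_smul, hE1, smul_eq_mul, mul_one]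
  have hcc : c * c = 1 := by
    have : ρ (torus s⁻¹) * (ρ (torus s) * E) = E := by
      rw [← mul_assoc, ← map_mul, ← map_mul, inv_mul_cancel, map_one, map_one, one_mul]
    rw [hc, mul_smul_comm] at this
    have := congrArg (LinearMap.trace ℂ V) this
    rwa [map_smul, htr (inv_ne_one.2 hs), hE1, character_eq_of_isConj ρ (isConj_torus_inv s), hsc,
      smul_eq_mul] at this
  have hpow (n : ℕ) : ρ (torus s ^ n) * E = c ^ n • E := by
    induction n with
    | zero => simp
    | succ n ih => rw [pow_succ, map_mul, mul_assoc, hc, mul_smul_comm, ih, smul_smul, pow_succ']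
  have hcard : c ^ (Fintype.card F - 1) = 1 := by
    have := congrArg (LinearMap.trace ℂ V) (hpow (Fintype.card F - 1))
    rw [← map_pow, ← Fintype.card_units, pow_card_eq_one, map_one, map_one, one_mul, map_smul, hE1,
      smul_eq_mul, mul_one] at this
    rw [← Fintype.card_units, this]
  have heven := FiniteField.even_card_of_char_two (ringChar.eq F 2)
  rw [character_torus_mul_upper ρ hs, hsc]
  obtain ⟨j, hj⟩ : ∃ j, Fintype.card F - 1 = 2 * j + 1 :=
    ⟨Fintype.card F / 2 - 1, by omega⟩
  rwa [hj, pow_succ, pow_mul, sq, hcc, one_pow, one_mul] at hcard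

end Representation

section Finite

variable [Fintype F]

lemma sum_borel [Fintype (borel F)] (f : Matrix.SpecialLinearGroup (Fin 2) F → ℂ)
    {a b c : ℂ} (h1 : f 1 = a) (hU : ∀ x ≠ 1, f (upper x) = b)
    (hT : ∀ s ≠ 1, ∀ x, f (torus s * upper x) = c) :
    ∑ g : borel F, f g = a + (Fintype.card F - 1) * b +
      (Fintype.card F - 2) * Fintype.card F * c := by
  classical
  have hF : 1 ≤ Fintype.card F := Fintype.card_pos
  have hF' : 2 ≤ Fintype.card F := Fintype.one_lt_card
  have hU1 : ∑ x, f (upper x) = a + (Fintype.card F - 1) * b := by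
    rw [← Finset.add_sum_erase _ _ (Finset.mem_univ 1), map_one, h1,
      Finset.sum_congr rfl fun x hx ↦ hU x (Finset.ne_of_mem_erase hx)]
    simp [Finset.card_erase_of_mem, Nat.cast_sub hF]
  rw [← borelEquiv.sum_comp, Fintype.sum_prod_type]
  simp only [coe_borelEquiv]
  rw [← Finset.add_sum_erase _ _ (Finset.mem_univ 1),
    Finset.sum_congr rfl fun s hs ↦ Finset.sum_congr rfl fun x _ ↦
      hT s (Finset.ne_of_mem_erase hs) x]
  simp only [map_one, one_mul, hU1, Finset.sum_const, Finset.card_univ, nsmul_eq_mul,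
    Finset.card_erase_of_mem (Finset.mem_univ _), Fintype.card_units, Fintype.card_multiplicative,
    Nat.sub_sub, Nat.cast_sub hF']
  push_cast
  ring

lemma sum_permChar_borel [Fintype (borel F)] :
    ∑ b : borel F, (borel F).permChar b = 2 * Nat.card (borel F) := by
  have := Fintype.ofFinite (Matrix.SpecialLinearGroup (Fin 2) F)
  have hF : 1 ≤ Fintype.card F := Fintype.card_pos
  have hb : (Nat.card (borel F) : ℂ) ≠ 0 := by simp
  rw [(borel F).sum_permChar_of_card_inter_conj fun h hh ↦ natCard_borel_inter_conj hh,
    div_eq_iff hb, natCard_eq, natCard_borel]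
  push_cast [hF]
  ring

lemma natCard_borel_cast :
    (Nat.card (borel F) : ℂ) = (Fintype.card F - 1) * Fintype.card F := by
  have hF : 1 ≤ Fintype.card F := Fintype.card_pos
  push_cast [natCard_borel, hF]
  rfl

variable [CharP F 2] [Fintype (Matrix.SpecialLinearGroup (Fin 2) F)]

open CategoryTheory

/-- The irreducible character of degree `q` is the permutation character on the cosets of the Borel
subgroup, minus the trivial character. -/
lemma character_eq_permChar_sub_one (hq : 4 ≤ Fintype.card F)
    (W : FDRep ℂ (Matrix.SpecialLinearGroup (Fin 2) F)) [Simple W]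
    (hW : W.character 1 = Fintype.card F) (g : Matrix.SpecialLinearGroup (Fin 2) F) :
    W.character g = (borel F).permChar g - 1 := by
  classical
  have hW1 : W.character 1 ≠ 1 := by
    rw [hW]
    exact_mod_cast (by omega : Fintype.card F ≠ 1)
  obtain ⟨hU, hT⟩ := character_borel_of_finrank W.ρ hq (W.exists_ρ_ne_one hW1)
    (by exact_mod_cast W.char_one.symm.trans hW)
  have hb : (Nat.card (borel F) : ℂ) ≠ 0 := by simp
  have hψπ : ∑ g, W.character g * (borel F).permChar g =
      Nat.card (Matrix.SpecialLinearGroup (Fin 2) F) := by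
    rw [Subgroup.sum_mul_permChar _ _ fun g h ↦ W.char_conj g h,
      sum_borel W.character hW hU hT, div_mul_eq_mul_div, div_eq_iff hb, natCard_borel_cast]
    ring
  have hππ : ∑ g, (borel F).permChar g * (borel F).permChar g =
      2 * Nat.card (Matrix.SpecialLinearGroup (Fin 2) F) := by
    rw [Subgroup.sum_mul_permChar _ _ (borel F).permChar_conj, sum_permChar_borel]
    field_simp
  have hπ : ∑ g, (borel F).permChar g = Nat.card (Matrix.SpecialLinearGroup (Fin 2) F) := by
    have := (borel F).sum_mul_permChar (fun _ ↦ 1) fun _ _ ↦ rfl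
    simp only [one_mul, Finset.sum_const, Finset.card_univ, nsmul_eq_mul, mul_one,
      ← Nat.card_eq_fintype_card] at this
    rwa [div_mul_cancel₀ _ hb] at this
  have hψψ : ∑ g, W.character g * W.character g =
      Nat.card (Matrix.SpecialLinearGroup (Fin 2) F) := by
    rw [← W.sum_character_mul_character_inv]
    exact Finset.sum_congr rfl fun g _ ↦ congrArg _ (character_inv W.ρ g).symm
  have hψ := W.sum_character_eq_zero hW1
  let D (g : Matrix.SpecialLinearGroup (Fin 2) F) : ℂ :=
    W.character g - ((borel F).permChar g - 1)
  have hDconj (g) : (starRingEnd ℂ) (D g) = D g := by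
    have : (starRingEnd ℂ) (W.character g) = W.character g :=
      (Representation.character_inv_eq_conj W.ρ g).symm.trans (character_inv W.ρ g)
    simp only [D, map_sub, map_one, this, Subgroup.conj_permChar]
  have hD : ∑ g, D g * D g = 0 := by
    have hg (g) : D g * D g = W.character g * W.character g +
        (borel F).permChar g * (borel F).permChar g + 1 -
        2 * (W.character g * (borel F).permChar g) + 2 * W.character g -
        2 * (borel F).permChar g := by
      simp only [D]
      ring
    simp only [hg, Finset.sum_add_distrib, Finset.sum_sub_distrib, ← Finset.mul_sum, hψψ, hππ,
      hψπ, hψ, hπ, Finset.sum_const, Finset.card_univ, nsmul_eq_mul, ← Nat.card_eq_fintype_card]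
    ring
  have hD' : ∑ g, Complex.normSq (D g) = 0 := by
    have hg (g) : D g * D g = (Complex.normSq (D g) : ℂ) := by
      rw [← Complex.mul_conj, hDconj]
    simp only [hg] at hD
    exact_mod_cast hD
  have := (Finset.sum_eq_zero_iff_of_nonneg fun g _ ↦ Complex.normSq_nonneg (D g)).1 hD' g
    (Finset.mem_univ g)
  exact sub_eq_zero.1 (Complex.normSq_eq_zero.1 this)

/-- The square of an irreducible character of degree `q - 1` has the same scalar product with the
permutation character on the cosets of the Borel subgroup as with the trivial character. -/
lemma sum_character_sq_mul_permChar (hq : 4 ≤ Fintype.card F)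
    (V : FDRep ℂ (Matrix.SpecialLinearGroup (Fin 2) F)) [Simple V]
    (hV : V.character 1 = Fintype.card F - 1) :
    ∑ g, V.character g ^ 2 * (borel F).permChar g = ∑ g, V.character g ^ 2 := by
  classical
  have hd : Module.finrank ℂ V + 1 = Fintype.card F := by
    have := V.char_one.symm.trans hV
    rw [eq_sub_iff_add_eq] at this
    exact_mod_cast this
  have hV1 : V.character 1 ≠ 1 := by
    rw [V.char_one]
    exact_mod_cast (by omega : Module.finrank ℂ V ≠ 1)
  obtain ⟨hU, hT⟩ := character_borel_of_finrank_add_one V.ρ (V.exists_ρ_ne_one hV1) hd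
  have hb : (Nat.card (borel F) : ℂ) ≠ 0 := by simp
  have hχχ : ∑ g, V.character g ^ 2 = Nat.card (Matrix.SpecialLinearGroup (Fin 2) F) := by
    rw [← V.sum_character_mul_character_inv]
    exact Finset.sum_congr rfl fun g _ ↦
      (sq _).trans (congrArg _ (character_inv V.ρ g).symm)
  rw [hχχ, Subgroup.sum_mul_permChar _ _ fun g h ↦ by rw [V.char_conj],
    sum_borel (fun g ↦ V.character g ^ 2) (congrArg (· ^ 2) hV)
      (fun x hx ↦ congrArg (· ^ 2) (hU x hx)) (fun s hs x ↦ congrArg (· ^ 2) (hT s hs x)),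
    div_mul_eq_mul_div, div_eq_iff hb, natCard_borel_cast]
  ring

end Finite

end SL2

/-- For `q ≥ 8` a power of `2` and `G = SL₂(F_q)`, the square of an irreducible character
of degree `q - 1` does not contain the Steinberg character (of degree `q`). -/
theorem sl2_even_degree_q_minus_one_square_misses_steinberg
    (q : ℕ) (hq8 : 8 ≤ q) (hq : ∃ n : ℕ, 1 ≤ n ∧ q = 2 ^ n)
    (F : Type) [Field F] [Fintype F] (hF : Fintype.card F = q)
    (χ ψ : Matrix.SpecialLinearGroup (Fin 2) F → ℂ)
    (hχ : IsIrreducibleCharacter _ χ) (hχdeg : χ 1 = (q : ℂ) - 1)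
    (hψ : IsIrreducibleCharacter _ ψ) (hψdeg : ψ 1 = (q : ℂ)) :
    charInner (fun g => χ g ^ 2) ψ = 0 := by
  obtain ⟨V, hV, rfl⟩ := hχ
  obtain ⟨W, hW, rfl⟩ := hψ
  subst hF
  have : CharP F 2 := by
    obtain ⟨n, hn, hcard⟩ := hq
    refine ringChar.of_eq (FiniteField.even_card_iff_char_two.2 ?_)
    rw [hcard, ← Nat.even_iff]
    exact even_two.pow_of_ne_zero (by omega)
  let := Fintype.ofFinite (Matrix.SpecialLinearGroup (Fin 2) F)
  have hq4 : 4 ≤ Fintype.card F := by omega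
  refine mul_eq_zero_of_right _ ?_
  simp only [SL2.character_eq_permChar_sub_one hq4 W hψdeg, map_sub, map_one,
    Subgroup.conj_permChar, mul_sub, mul_one, Finset.sum_sub_distrib]
  exact sub_eq_zero.2 (SL2.sum_character_sq_mul_permChar hq4 V hχdeg)
end
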